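/- Let d_κ = (d_{iκ})_{i=1}^{n_κ} (κ ≥ 1) be finite sequences of integers satisfying: n_κ → ∞; for every integer k, the empirical frequencies p_k(d_κ) := #{i ≤ n_κ : d_{iκ} = k}/n_κ converge to p_k, where p = (p_k)_{k∈ℤ} is a nonlattice probability distribution on ℤ; Q_κ := Σ_{i=1}^{n_κ}(d_{iκ} − d̄_κ)² = O(n_κ), where d̄_κ := (1/n_κ)Σ_i d_{iκ}; and the Lindeberg condition holds: for every ε > 0, Q_κ^{−1} Σ_{i : |d_{iκ}−d̄_κ| > ε σ̂_κ} (d_{iκ} − d̄_κ)² → 0 as κ → ∞, where σ̂_κ² := (m_κ/n_κ)(1 − m_κ/n_κ)Q_κ for given integers 0 ≤ m_κ ≤ n_κ. Let S_{m_κ} := Σ_{i=1}^{m_κ} d_{τ(i),κ} for a uniformly random permutation τ of {1,…,n_κ} (the sum of m_κ values drawn without replacement). Then, as κ → ∞, uniformly over all integers k, P(S_{m_κ} = k) = (2π σ̂_κ²)^{−1/2} · ( exp(−(k − m_κ d̄_κ)²/(2σ̂_κ²)) + o(1) ). -/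

import Mathlib

/-!
Common definitions: plane rooted trees, fringe subtree counts, random trees with
a given degree statistic, Poisson/normal limit notions, conditioned Galton–Watson
trees, and sampling without replacement.
-/

open Filter MeasureTheory
open scoped Topology Classical

/-- A plane rooted tree: a root together with a linearly ordered (possibly empty)
list of subtrees. Structural equality coincides with isomorphism of plane rooted trees. -/
inductive PlaneTree : Type
  | node : List PlaneTree → PlaneTree

namespace PlaneTree

/-- The (out)degree of the root: its number of children. -/
def degree : PlaneTree → ℕ
  | node ts => ts.length

mutual
  /-- The list of all fringe subtrees of a tree (one for each vertex). -/
  def fringe : PlaneTree → List PlaneTree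
    | node ts => node ts :: fringeList ts
  def fringeList : List PlaneTree → List PlaneTree
    | [] => []
    | t :: ts => fringe t ++ fringeList ts
end

/-- The number of vertices `|T|` of a plane tree. -/
def size (T : PlaneTree) : ℕ := T.fringe.length

/-- The degree statistic `n_T` of a tree: `n_T(i)` is the number of vertices with `i` children. -/
noncomputable def degStat (T : PlaneTree) : ℕ →₀ ℕ :=
  Multiset.toFinsupp ((T.fringe.map degree : List ℕ) : Multiset ℕ)

/-- `N_{T'}(T)`: the number of fringe subtrees of `T` equal to `T'`. -/
noncomputable def countTree (T' T : PlaneTree) : ℕ :=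
  (T.fringe.filter fun t => decide (t = T')).length

/-- `N_m(T)` for a degree statistic `m`: the number of fringe subtrees of `T`
with degree statistic `m`. -/
noncomputable def countStat (m : ℕ →₀ ℕ) (T : PlaneTree) : ℕ :=
  (T.fringe.filter fun t => decide (degStat t = m)).length

/-- `N_m(T)` for an integer `m`: the number of fringe subtrees of `T` of size `m`. -/
noncomputable def countSize (m : ℕ) (T : PlaneTree) : ℕ :=
  (T.fringe.filter fun t => decide (size t = m)).length

end PlaneTree

/-- `n : ℕ →₀ ℕ` is a degree statistic: `∑ n(i) = 1 + ∑ i·n(i)`. -/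
def IsDegStat (n : ℕ →₀ ℕ) : Prop :=
  (n.sum fun _ c => c) = 1 + n.sum fun i c => i * c

/-- `|n| = ∑_i n(i)`, the size of a degree statistic. -/
def nsize (n : ℕ →₀ ℕ) : ℕ := n.sum fun _ c => c

/-- The set `𝕋_n` of plane trees with degree statistic `n`. -/
def treesWith (n : ℕ →₀ ℕ) : Set PlaneTree := {T | PlaneTree.degStat T = n}

/-- `|𝕋_n|`, the number of plane trees with degree statistic `n`. -/
noncomputable def numTrees (n : ℕ →₀ ℕ) : ℕ := (treesWith n).ncard

/-- The probability that a uniformly random tree `𝒯_n ∈ 𝕋_n` satisfies `P`. -/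
noncomputable def prob (n : ℕ →₀ ℕ) (P : PlaneTree → Prop) : ℝ :=
  (({T ∈ treesWith n | P T}).ncard : ℝ) / (numTrees n : ℝ)

/-- The expectation `E[f(𝒯_n)]` of an `ℕ`-valued functional of the uniformly
random tree `𝒯_n ∈ 𝕋_n`. -/
noncomputable def expect (n : ℕ →₀ ℕ) (f : PlaneTree → ℕ) : ℝ :=
  ∑' k : ℕ, (k : ℝ) * prob n (fun T => f T = k)

/-- The variance `Var[f(𝒯_n)]`. -/
noncomputable def variance (n : ℕ →₀ ℕ) (f : PlaneTree → ℕ) : ℝ :=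
  expect n (fun T => (f T) ^ 2) - (expect n f) ^ 2

/-- The empirical degree distribution `p_i(n) = n(i)/|n|`. -/
noncomputable def empDist (n : ℕ →₀ ℕ) (i : ℕ) : ℝ := (n i : ℝ) / (nsize n : ℝ)

/-- `π_p(T) = ∏_{i ≥ 0} p_i^{n_T(i)}`. -/
noncomputable def piDist (p : ℕ → ℝ) (T : PlaneTree) : ℝ :=
  (PlaneTree.degStat T).prod fun i c => p i ^ c

/-- `π_p(𝕋_m) = |𝕋_m| · ∏_{i ≥ 0} p_i^{m(i)}`. -/
noncomputable def piSet (p : ℕ → ℝ) (m : ℕ →₀ ℕ) : ℝ :=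
  (numTrees m : ℝ) * m.prod fun i c => p i ^ c

/-- Condition 1: the `nseq κ` are degree statistics with `|n_κ| → ∞` and
`p_i(n_κ) → p_i` for every `i`, where `p` is a probability distribution on `ℕ`. -/
def Condition1 (nseq : ℕ → (ℕ →₀ ℕ)) (p : ℕ → ℝ) : Prop :=
  (∀ κ, IsDegStat (nseq κ)) ∧
  Tendsto (fun κ => nsize (nseq κ)) atTop atTop ∧
  (∀ i, 0 ≤ p i) ∧ HasSum p 1 ∧
  (∀ i, Tendsto (fun κ => empDist (nseq κ) i) atTop (𝓝 (p i)))

/-- Condition 2: in addition, `∑ i² p_i(n_κ) → ∑ i² p_i < ∞`. -/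
def Condition2 (nseq : ℕ → (ℕ →₀ ℕ)) (p : ℕ → ℝ) : Prop :=
  Summable (fun i : ℕ => (i : ℝ) ^ 2 * p i) ∧
  Tendsto (fun κ => ∑' i : ℕ, (i : ℝ) ^ 2 * empDist (nseq κ) i) atTop
    (𝓝 (∑' i : ℕ, (i : ℝ) ^ 2 * p i))

/-- `σ_p² = ∑_{i ≥ 0} (i-1)² p_i`. -/
noncomputable def sigmaSq (p : ℕ → ℝ) : ℝ := ∑' i : ℕ, ((i : ℝ) - 1) ^ 2 * p i

/-- The point probabilities of the Poisson distribution `Po(lam)`. -/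
noncomputable def poissonPMF (lam : ℝ) (k : ℕ) : ℝ :=
  Real.exp (-lam) * lam ^ k / (Nat.factorial k : ℝ)

/-- The `q`-th moment of the Poisson distribution `Po(lam)`. -/
noncomputable def poissonMoment (lam : ℝ) (q : ℕ) : ℝ :=
  ∑' k : ℕ, (k : ℝ) ^ q * poissonPMF lam k

/-- The standard normal cumulative distribution function. -/
noncomputable def stdNormalCDF (x : ℝ) : ℝ :=
  ∫ t in Set.Iic x, Real.exp (-t ^ 2 / 2) / Real.sqrt (2 * Real.pi)

/-- The total variation distance between the law of `f(𝒯_n)` and `Po(lam)`: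
`sup_A |P(f(𝒯_n) ∈ A) − Po(lam)(A)|`. -/
noncomputable def dTVPoisson (n : ℕ →₀ ℕ) (f : PlaneTree → ℕ) (lam : ℝ) : ℝ :=
  ⨆ A : Set ℕ, |prob n (fun T => f T ∈ A) - ∑' k : ℕ, A.indicator (poissonPMF lam) k|

/-- A probability distribution on `ℕ` is nonlattice: the gcd of the differences of
points of its support is `1`. -/
def Nonlattice (p : ℕ → ℝ) : Prop :=
  ∀ h : ℕ, (∀ i j : ℕ, 0 < p i → 0 < p j → (h : ℤ) ∣ (i : ℤ) - (j : ℤ)) → h = 1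

/-- The partition function `P(|𝒯_p| = n)` of a Galton–Watson tree with offspring
distribution `p`. -/
noncomputable def gwZ (p : ℕ → ℝ) (n : ℕ) : ℝ :=
  ∑' T : PlaneTree, if PlaneTree.size T = n then piDist p T else 0

/-- `P(𝒯_{p,n} ∈ {T | P T})` for the conditioned Galton–Watson tree `𝒯_{p,n}`. -/
noncomputable def probGW (p : ℕ → ℝ) (n : ℕ) (P : PlaneTree → Prop) : ℝ :=
  (∑' T : PlaneTree, if PlaneTree.size T = n ∧ P T then piDist p T else 0) / gwZ p n

/-- The expectation `E[f(𝒯_{p,n})]` for an `ℕ`-valued functional. -/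
noncomputable def expectGW (p : ℕ → ℝ) (n : ℕ) (f : PlaneTree → ℕ) : ℝ :=
  ∑' k : ℕ, (k : ℝ) * probGW p n (fun T => f T = k)

/-- The filter `n → ∞` along the sizes `n` for which the conditioning `|𝒯_p| = n`
is well defined. -/
noncomputable def gwFilter (p : ℕ → ℝ) : Filter ℕ :=
  atTop ⊓ Filter.principal {n | 0 < gwZ p n}

/-- A positive function on the positive reals is slowly varying at infinity. -/
def SlowlyVarying (L : ℝ → ℝ) : Prop :=
  (∀ x : ℝ, 0 < x → 0 < L x) ∧
  ∀ c : ℝ, 0 < c → Tendsto (fun x : ℝ => L (c * x) / L x) atTop (𝓝 1)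

/-- The probability that a uniformly random permutation of `Fin n` satisfies `P`. -/
noncomputable def probPerm {n : ℕ} (P : Equiv.Perm (Fin n) → Prop) : ℝ :=
  ((Finset.univ.filter P).card : ℝ) / ((Finset.univ : Finset (Equiv.Perm (Fin n))).card : ℝ)

/-- `S_m = ∑_{i=1}^m d_{τ(i)}`: the sum of `m` of the values `d`, drawn without
replacement via the permutation `τ`. -/
def sampleSum {n : ℕ} (d : Fin n → ℤ) (m : ℕ) (τ : Equiv.Perm (Fin n)) : ℤ :=
  ∑ i : Fin n, if (i : ℕ) < m then d (τ i) else 0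

/-- The mean `d̄` of the values `d`. -/
noncomputable def dbar {n : ℕ} (d : Fin n → ℤ) : ℝ := (∑ i : Fin n, (d i : ℝ)) / n

/-- `Q = ∑_i (d_i − d̄)²`. -/
noncomputable def Qval {n : ℕ} (d : Fin n → ℤ) : ℝ := ∑ i : Fin n, ((d i : ℝ) - dbar d) ^ 2

/-- `σ̂² = (m/n)(1 − m/n) Q`. -/
noncomputable def sigHatSq {n : ℕ} (d : Fin n → ℤ) (m : ℕ) : ℝ :=
  ((m : ℝ) / n) * (1 - (m : ℝ) / n) * Qval d

/-- The empirical frequency `p_k(d) = #{i : d_i = k}/n`. -/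
noncomputable def empFreq {n : ℕ} (d : Fin n → ℤ) (k : ℤ) : ℝ :=
  ((Finset.univ.filter (fun i => d i = k)).card : ℝ) / n

/-- The characteristic function `φ_{S_m}(t) = E[exp(i t S_m)]` of the sample sum. -/
noncomputable def charFn {n : ℕ} (d : Fin n → ℤ) (m : ℕ) (t : ℝ) : ℂ :=
  (Fintype.card (Equiv.Perm (Fin n)) : ℂ)⁻¹ *
    ∑ τ : Equiv.Perm (Fin n), Complex.exp (Complex.I * t * (sampleSum d m τ : ℂ))

/-- A probability distribution on `ℤ` is nonlattice. -/
def NonlatticeZ (p : ℤ → ℝ) : Prop :=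
  ∀ h : ℕ, (∀ i j : ℤ, 0 < p i → 0 < p j → (h : ℤ) ∣ i - j) → h = 1

open Finset in
/-- A uniformly random permutation carries a fixed set of size `m` to a uniformly random set of
size `m`. -/
lemma card_perm_map_filter_mul_choose {n : ℕ} (A₀ : Finset (Fin n)) (P : Finset (Fin n) → Prop) :
    #{τ : Equiv.Perm (Fin n) | P (A₀.map τ.toEmbedding)} * n.choose #A₀ =
      #{A ∈ powersetCard #A₀ (univ : Finset (Fin n)) | P A} *
        #(univ : Finset (Equiv.Perm (Fin n))) := by
  have fiber : ∀ A ∈ powersetCard #A₀ (univ : Finset (Fin n)),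
      #{τ : Equiv.Perm (Fin n) | A₀.map τ.toEmbedding = A} =
        #{τ : Equiv.Perm (Fin n) | A₀.map τ.toEmbedding = A₀} := by
    intro A hA
    have hcard : #A₀ = #A := (mem_powersetCard.1 hA).2.symm
    let e : {x // x ∈ A₀} ≃ {x // x ∈ A} := Finset.equivOfCardEq hcard
    let σ : Equiv.Perm (Fin n) := e.extendSubtype
    have hσ : A₀.map σ.toEmbedding = A := by
      refine Finset.eq_of_subset_of_card_le ?_ (by simp [hcard])
      intro x hx
      obtain ⟨y, hy, rfl⟩ := Finset.mem_map.1 hx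
      exact e.extendSubtype_mem y hy
    refine Finset.card_bij' (fun τ _ => σ⁻¹ * τ) (fun τ _ => σ * τ) ?_ ?_ ?_ ?_
    · intro τ hτ
      simp only [mem_filter, mem_univ, true_and] at hτ ⊢
      rw [← Finset.map_inj (f := σ.toEmbedding), hσ, ← hτ, Finset.map_map]
      congr 1
      ext x
      simp
    · intro τ hτ
      simp only [mem_filter, mem_univ, true_and] at hτ ⊢
      conv_rhs => rw [← hσ, ← hτ, Finset.map_map]
      congr 1
    · intro τ _
      simp
    · intro τ _
      simp
  have count : ∀ R : Finset (Fin n) → Prop,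
      #{τ : Equiv.Perm (Fin n) | R (A₀.map τ.toEmbedding)} =
        #{A ∈ powersetCard #A₀ (univ : Finset (Fin n)) | R A} *
          #{τ : Equiv.Perm (Fin n) | A₀.map τ.toEmbedding = A₀} := by
    intro R
    rw [Finset.card_eq_sum_card_fiberwise (f := fun τ : Equiv.Perm (Fin n) =>
      A₀.map τ.toEmbedding) (t := {A ∈ powersetCard #A₀ (univ : Finset (Fin n)) | R A})]
    · rw [Finset.sum_const_nat]
      intro A hA
      rw [mem_filter] at hA
      rw [← fiber A hA.1, Finset.filter_filter]
      congr 1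
      ext τ
      simp only [mem_filter, mem_univ, true_and, and_iff_right_iff_imp]
      rintro rfl
      exact hA.2
    · intro τ hτ
      simp only [coe_filter, mem_univ, true_and, Set.mem_ofPred_eq] at hτ
      simp [mem_powersetCard, hτ]
  have htot := count fun _ => True
  simp only [Finset.filter_true, card_powersetCard, card_univ, Fintype.card_fin] at htot
  rw [count P, card_univ, htot]
  ring

open Finset in
lemma probPerm_sampleSum_mul_choose {n m : ℕ} (hm : m ≤ n) (d : Fin n → ℤ) (k : ℤ) :
    probPerm (fun τ => sampleSum d m τ = k) * n.choose m =
      #{A ∈ powersetCard m (univ : Finset (Fin n)) | ∑ i ∈ A, d i = k} := by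
  have hcard : #{i : Fin n | (i : ℕ) < m} = m := by
    rw [Fin.card_filter_val_lt, min_eq_right hm]
  have hsum : ∀ τ : Equiv.Perm (Fin n), sampleSum d m τ =
      ∑ i ∈ ({i : Fin n | (i : ℕ) < m} : Finset (Fin n)).map τ.toEmbedding, d i := by
    intro τ
    simp [sampleSum, Finset.sum_filter]
  have h := card_perm_map_filter_mul_choose ({i : Fin n | (i : ℕ) < m} : Finset (Fin n))
    (fun A => ∑ i ∈ A, d i = k)
  rw [hcard] at h
  have hpos : (#(univ : Finset (Equiv.Perm (Fin n))) : ℝ) ≠ 0 := by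
    rw [Nat.cast_ne_zero]
    exact (Finset.card_pos.2 univ_nonempty).ne'
  rw [probPerm, div_mul_eq_mul_div, div_eq_iff hpos]
  simp only [hsum]
  norm_cast
  convert h

lemma integral_exp_I_int_mul (j : ℤ) :
    ∫ s in (-Real.pi)..Real.pi, Complex.exp (Complex.I * (j * s)) =
      if j = 0 then 2 * (Real.pi : ℂ) else 0 := by
  split_ifs with hj
  · simp [hj]
    ring
  · have hc : Complex.I * (j : ℂ) ≠ 0 := mul_ne_zero Complex.I_ne_zero (by exact_mod_cast hj)
    simp only [← mul_assoc]
    rw [integral_exp_mul_complex hc, div_eq_zero_iff]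
    left
    rw [sub_eq_zero, Complex.exp_eq_exp_iff_exists_int]
    exact ⟨j, by push_cast; ring⟩

open Finset in
lemma prod_one_sub_add_mul_exp {n : ℕ} (q : ℝ) (d : Fin n → ℤ) (s t : ℝ) :
    ∏ j, ((1 - q : ℂ) + q * Complex.exp (Complex.I * ((s + t * d j : ℝ) : ℂ))) =
      ∑ A : Finset (Fin n), (q : ℂ) ^ #A * (1 - q : ℂ) ^ (n - #A) *
        (Complex.exp (Complex.I * ((#A : ℤ) * s)) *
          Complex.exp (Complex.I * ((∑ i ∈ A, d i : ℤ) * t))) := by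
  simp only [add_comm (1 - q : ℂ)]
  rw [Finset.prod_add, Finset.powerset_univ]
  refine Finset.sum_congr rfl fun A _ => ?_
  rw [Finset.prod_mul_distrib, Finset.prod_const, Finset.prod_const,
    Finset.card_sdiff_of_subset (subset_univ A), card_univ, Fintype.card_fin,
    ← Complex.exp_sum, ← Complex.exp_add, mul_right_comm]
  congr 2
  rw [← Finset.mul_sum, ← mul_add]
  push_cast
  rw [Finset.sum_add_distrib, Finset.sum_const, ← Finset.mul_sum, nsmul_eq_mul]
  ring

open Finset in
/-- Fourier inversion for the joint law of a sum of Bernoulli variables and their sum weighted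
by `d`. -/
lemma integral_integral_prod_bernoulli {n : ℕ} (m : ℕ) (q : ℝ) (d : Fin n → ℤ) (k : ℤ) :
    ∫ t in (-Real.pi)..Real.pi, ∫ s in (-Real.pi)..Real.pi,
        Complex.exp (-Complex.I * (m * s + k * t)) *
          ∏ j, ((1 - q : ℂ) + q * Complex.exp (Complex.I * ((s + t * d j : ℝ) : ℂ))) =
      (2 * Real.pi) ^ 2 * ((q : ℂ) ^ m * (1 - q : ℂ) ^ (n - m)) *
        #{A ∈ powersetCard m (univ : Finset (Fin n)) | ∑ i ∈ A, d i = k} := by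
  have expand : ∀ s t : ℝ, Complex.exp (-Complex.I * (m * s + k * t)) *
      ∏ j, ((1 - q : ℂ) + q * Complex.exp (Complex.I * ((s + t * d j : ℝ) : ℂ))) =
      ∑ A : Finset (Fin n), (q : ℂ) ^ #A * (1 - q : ℂ) ^ (n - #A) *
        (Complex.exp (Complex.I * (((∑ i ∈ A, d i - k : ℤ) : ℂ) * t)) *
          Complex.exp (Complex.I * (((#A - m : ℤ) : ℂ) * s))) := by
    intro s t
    rw [prod_one_sub_add_mul_exp, Finset.mul_sum]
    refine Finset.sum_congr rfl fun A _ => ?_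
    rw [mul_left_comm, ← Complex.exp_add, ← Complex.exp_add, ← Complex.exp_add]
    congr 2
    push_cast
    ring
  simp only [expand]
  have inner : ∀ t : ℝ, ∫ s in (-Real.pi)..Real.pi, ∑ A : Finset (Fin n),
      (q : ℂ) ^ #A * (1 - q : ℂ) ^ (n - #A) *
        (Complex.exp (Complex.I * (((∑ i ∈ A, d i - k : ℤ) : ℂ) * t)) *
          Complex.exp (Complex.I * (((#A - m : ℤ) : ℂ) * s))) =
      ∑ A : Finset (Fin n), (q : ℂ) ^ #A * (1 - q : ℂ) ^ (n - #A) *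
        (Complex.exp (Complex.I * (((∑ i ∈ A, d i - k : ℤ) : ℂ) * t)) *
          if (#A - m : ℤ) = 0 then 2 * (Real.pi : ℂ) else 0) := by
    intro t
    rw [intervalIntegral.integral_finsetSum]
    · refine Finset.sum_congr rfl fun A _ => ?_
      rw [intervalIntegral.integral_const_mul, intervalIntegral.integral_const_mul,
        integral_exp_I_int_mul]
    · intro A _
      exact Continuous.intervalIntegrable (by fun_prop) _ _
  simp only [inner]
  rw [intervalIntegral.integral_finsetSum]
  · simp only [intervalIntegral.integral_const_mul, intervalIntegral.integral_mul_const,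
      integral_exp_I_int_mul]
    rw [Finset.card_filter, Nat.cast_sum, Finset.mul_sum, ← Finset.powerset_univ,
      ← Finset.sum_subset (s₁ := powersetCard m (univ : Finset (Fin n)))]
    · refine Finset.sum_congr rfl fun A hA => ?_
      rw [(mem_powersetCard.1 hA).2]
      simp only [sub_eq_zero, if_true]
      split_ifs <;> push_cast <;> ring
    · exact fun A _ => by simp
    · intro A _ hA
      have : ¬ ((#A : ℤ) - m = 0) := by
        intro h
        exact hA (mem_powersetCard.2 ⟨subset_univ A, by omega⟩)
      simp [this]
  · intro A _
    exact Continuous.intervalIntegrable (by fun_prop) _ _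

open Finset in
lemma integral_bernoulli_pow (n m : ℕ) (q : ℝ) :
    ∫ s in (-Real.pi)..Real.pi, Complex.exp (-Complex.I * (m * s)) *
        ((1 - q : ℂ) + q * Complex.exp (Complex.I * s)) ^ n =
      2 * Real.pi * ((q : ℂ) ^ m * (1 - q : ℂ) ^ (n - m)) * n.choose m := by
  have h := integral_integral_prod_bernoulli (n := n) m q (fun _ => 0) 0
  have hcard : #{A ∈ powersetCard m (univ : Finset (Fin n)) | ∑ i ∈ A, (0 : ℤ) = 0} =
      n.choose m := by
    simp
  rw [hcard] at h
  simp only [Int.cast_zero, mul_zero, zero_mul, add_zero, Finset.prod_const, card_univ,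
    Fintype.card_fin, intervalIntegral.integral_const, Complex.real_smul] at h
  have hpi : (2 * Real.pi : ℂ) ≠ 0 := by
    exact_mod_cast (mul_pos two_pos Real.pi_pos).ne'
  refine mul_left_cancel₀ hpi (Eq.trans ?_ (h.trans ?_))
  · push_cast
    ring
  · ring

/-- The characteristic function of a centred Bernoulli variable with success probability `q`. -/
noncomputable def centredBernoulliChar (q θ : ℝ) : ℂ :=
  (1 - q) * Complex.exp (Complex.I * (-q * θ : ℝ)) +
    q * Complex.exp (Complex.I * ((1 - q) * θ : ℝ))

lemma continuous_centredBernoulliChar (q : ℝ) : Continuous (centredBernoulliChar q) := by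
  unfold centredBernoulliChar
  fun_prop

lemma centredBernoulliChar_eq (q θ : ℝ) :
    centredBernoulliChar q θ = Complex.exp (Complex.I * (-q * θ : ℝ)) *
      ((1 - q : ℂ) + q * Complex.exp (Complex.I * (θ : ℂ))) := by
  rw [centredBernoulliChar, mul_add, mul_left_comm _ (q : ℂ), ← Complex.exp_add,
    mul_comm (Complex.exp _)]
  congr 4
  push_cast
  ring

lemma norm_centredBernoulliChar_le (q θ : ℝ) :
    ‖centredBernoulliChar q θ‖ ≤ Real.exp (-(q * (1 - q) * (1 - Real.cos θ))) := by
  rw [centredBernoulliChar_eq, norm_mul, Complex.norm_exp_I_mul_ofReal, one_mul]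
  refine le_of_sq_le_sq ?_ (Real.exp_pos _).le
  have hsq : ‖(1 - q : ℂ) + q * Complex.exp (Complex.I * (θ : ℂ))‖ ^ 2 =
      -(2 * (q * (1 - q) * (1 - Real.cos θ))) + 1 := by
    rw [mul_comm Complex.I, Complex.exp_mul_I, ← Complex.ofReal_cos, ← Complex.ofReal_sin,
      Complex.sq_norm, Complex.normSq_apply]
    simp [-Complex.ofReal_cos, -Complex.ofReal_sin]
    linear_combination q ^ 2 * Real.sin_sq_add_cos_sq θ
  rw [hsq, ← Real.exp_nat_mul]
  refine (Real.add_one_le_exp _).trans_eq ?_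
  congr 1
  push_cast
  ring

lemma norm_centredBernoulliChar_le_one {q : ℝ} (hq0 : 0 ≤ q) (hq1 : q ≤ 1) (θ : ℝ) :
    ‖centredBernoulliChar q θ‖ ≤ 1 := by
  refine (norm_centredBernoulliChar_le q θ).trans (Real.exp_le_one_iff.2 ?_)
  have := Real.cos_le_one θ
  have := mul_nonneg (mul_nonneg hq0 (sub_nonneg.2 hq1)) (sub_nonneg.2 this)
  linarith

lemma norm_exp_I_mul_sub_quadratic_le {x : ℝ} (hx : |x| ≤ 1) :
    ‖Complex.exp (Complex.I * x) - (1 + Complex.I * x - x ^ 2 / 2)‖ ≤ |x| ^ 3 := by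
  have hnorm : ‖Complex.I * (x : ℂ)‖ = |x| := by simp
  have h := Complex.exp_bound (x := Complex.I * x) (by rwa [hnorm]) (n := 3) (by norm_num)
  rw [hnorm] at h
  have hsum : ∑ k ∈ Finset.range 3, (Complex.I * (x : ℂ)) ^ k / (k.factorial : ℂ) =
      1 + Complex.I * x - x ^ 2 / 2 := by
    simp only [Finset.sum_range_succ, Finset.sum_range_zero, mul_pow, Complex.I_sq]
    norm_num
    ring
  rw [hsum] at h
  refine h.trans ?_
  have h3 : 0 ≤ |x| ^ 3 := by positivity
  norm_num [Nat.factorial]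
  linarith

lemma norm_exp_I_mul_sub_linear_le (x : ℝ) :
    ‖Complex.exp (Complex.I * x) - (1 + Complex.I * x)‖ ≤ 3 * x ^ 2 := by
  have hnorm : ‖Complex.I * (x : ℂ)‖ = |x| := by simp
  rcases le_or_gt |x| 1 with hx | hx
  · have h := Complex.norm_exp_sub_one_sub_id_le (x := Complex.I * x) (by rwa [hnorm])
    rw [hnorm, sq_abs] at h
    rw [← sub_sub]
    nlinarith [sq_nonneg x]
  · have h1 : ‖Complex.exp (Complex.I * x) - (1 + Complex.I * x)‖ ≤ 1 + (1 + |x|) := by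
      refine (norm_sub_le _ _).trans (add_le_add (Complex.norm_exp_I_mul_ofReal x).le ?_)
      refine (norm_add_le _ _).trans ?_
      rw [hnorm, norm_one]
    rw [← sq_abs]
    nlinarith

lemma norm_centredBernoulliChar_sub_exp_le {q : ℝ} (hq0 : 0 ≤ q) (hq1 : q ≤ 1) (θ : ℝ) :
    ‖centredBernoulliChar q θ - Real.exp (-(q * (1 - q) * θ ^ 2 / 2))‖ ≤
      4 * (q * (1 - q) * θ ^ 2) := by
  have h1q := sub_nonneg.2 hq1
  have hv : 0 ≤ q * (1 - q) * θ ^ 2 := by positivity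
  have e : centredBernoulliChar q θ - 1 =
      (1 - q : ℝ) * (Complex.exp (Complex.I * (-q * θ : ℝ)) - (1 + Complex.I * (-q * θ : ℝ))) +
      (q : ℝ) * (Complex.exp (Complex.I * ((1 - q) * θ : ℝ)) -
        (1 + Complex.I * ((1 - q) * θ : ℝ))) := by
    rw [centredBernoulliChar]
    push_cast
    ring
  have b1 : ‖centredBernoulliChar q θ - 1‖ ≤ 3 * (q * (1 - q) * θ ^ 2) := by
    rw [e]
    refine (norm_add_le _ _).trans ?_
    rw [norm_mul, norm_mul, Complex.norm_real, Complex.norm_real, Real.norm_of_nonneg h1q,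
      Real.norm_of_nonneg hq0]
    have := mul_le_mul_of_nonneg_left (norm_exp_I_mul_sub_linear_le (-q * θ)) h1q
    have := mul_le_mul_of_nonneg_left (norm_exp_I_mul_sub_linear_le ((1 - q) * θ)) hq0
    nlinarith
  have b2 : ‖(1 : ℂ) - Real.exp (-(q * (1 - q) * θ ^ 2 / 2))‖ ≤ q * (1 - q) * θ ^ 2 := by
    rw [← Complex.ofReal_one, ← Complex.ofReal_sub, Complex.norm_real, Real.norm_eq_abs, abs_le]
    have h1 := Real.add_one_le_exp (-(q * (1 - q) * θ ^ 2 / 2))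
    have h2 := Real.exp_le_one_iff.2 (show -(q * (1 - q) * θ ^ 2 / 2) ≤ 0 by linarith)
    constructor <;> linarith
  calc _ = ‖(centredBernoulliChar q θ - 1) + (1 - Real.exp (-(q * (1 - q) * θ ^ 2 / 2)))‖ := by
        congr 1; ring
    _ ≤ _ := (norm_add_le _ _).trans (by linarith)

lemma norm_centredBernoulliChar_sub_exp_le_of_abs_le {q ε : ℝ} (hq0 : 0 ≤ q) (hq1 : q ≤ 1)
    (hε : ε ≤ 1) {θ : ℝ} (hθ : |θ| ≤ ε) :
    ‖centredBernoulliChar q θ - Real.exp (-(q * (1 - q) * θ ^ 2 / 2))‖ ≤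
      2 * ε * (q * (1 - q) * θ ^ 2) := by
  have h1q := sub_nonneg.2 hq1
  have hθ1 : |θ| ≤ 1 := hθ.trans hε
  have hv : 0 ≤ q * (1 - q) * θ ^ 2 := by positivity
  have hqq : q * (1 - q) ≤ 1 := by nlinarith
  have hθ2 : θ ^ 2 ≤ |θ| := by
    rw [← sq_abs]; nlinarith [abs_nonneg θ]
  have e : centredBernoulliChar q θ - (1 - q * (1 - q) * θ ^ 2 / 2) =
      (1 - q : ℝ) * (Complex.exp (Complex.I * (-q * θ : ℝ)) -
        (1 + Complex.I * (-q * θ : ℝ) - ((-q * θ : ℝ) : ℂ) ^ 2 / 2)) +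
      (q : ℝ) * (Complex.exp (Complex.I * ((1 - q) * θ : ℝ)) -
        (1 + Complex.I * ((1 - q) * θ : ℝ) - (((1 - q) * θ : ℝ) : ℂ) ^ 2 / 2)) := by
    rw [centredBernoulliChar]
    push_cast
    ring
  have a1 : |-q * θ| = q * |θ| := by rw [abs_mul, abs_neg, abs_of_nonneg hq0]
  have a2 : |(1 - q) * θ| = (1 - q) * |θ| := by rw [abs_mul, abs_of_nonneg h1q]
  have b1 : ‖centredBernoulliChar q θ - (1 - q * (1 - q) * θ ^ 2 / 2)‖ ≤
      |θ| * (q * (1 - q) * θ ^ 2) := by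
    rw [e]
    refine (norm_add_le _ _).trans ?_
    rw [norm_mul, norm_mul, Complex.norm_real, Complex.norm_real, Real.norm_of_nonneg h1q,
      Real.norm_of_nonneg hq0]
    have i1 := mul_le_mul_of_nonneg_left (norm_exp_I_mul_sub_quadratic_le (x := -q * θ)
      (by rw [a1]; nlinarith [abs_nonneg θ])) h1q
    have i2 := mul_le_mul_of_nonneg_left (norm_exp_I_mul_sub_quadratic_le (x := (1 - q) * θ)
      (by rw [a2]; nlinarith [abs_nonneg θ])) hq0
    rw [a1] at i1
    rw [a2] at i2
    refine (add_le_add i1 i2).trans ?_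
    rw [← sq_abs θ]
    have : (1 - q) * (q * |θ|) ^ 3 + q * ((1 - q) * |θ|) ^ 3 =
        |θ| * (q * (1 - q) * |θ| ^ 2) * (1 - 2 * (q * (1 - q))) := by ring
    rw [this]
    refine mul_le_of_le_one_right (by positivity) ?_
    nlinarith [mul_nonneg hq0 h1q]
  have b2 : ‖(1 - q * (1 - q) * θ ^ 2 / 2 : ℂ) - Real.exp (-(q * (1 - q) * θ ^ 2 / 2))‖ ≤
      |θ| * (q * (1 - q) * θ ^ 2) := by
    have hcast : (1 - q * (1 - q) * θ ^ 2 / 2 : ℂ) - Real.exp (-(q * (1 - q) * θ ^ 2 / 2)) =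
        ((1 - q * (1 - q) * θ ^ 2 / 2 - Real.exp (-(q * (1 - q) * θ ^ 2 / 2)) : ℝ) : ℂ) := by
      push_cast; ring
    have hv1 : q * (1 - q) * θ ^ 2 ≤ |θ| := by
      nlinarith [sq_nonneg θ]
    rw [hcast, Complex.norm_real, Real.norm_eq_abs]
    have h := Real.abs_exp_sub_one_sub_id_le (x := -(q * (1 - q) * θ ^ 2 / 2))
      (by rw [abs_neg, abs_of_nonneg (by linarith)]; linarith)
    rw [abs_sub_comm]
    refine le_trans (le_of_eq ?_) (h.trans ?_)
    · congr 1; ring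
    · nlinarith
  calc _ = ‖(centredBernoulliChar q θ - (1 - q * (1 - q) * θ ^ 2 / 2)) +
        ((1 - q * (1 - q) * θ ^ 2 / 2 : ℂ) - Real.exp (-(q * (1 - q) * θ ^ 2 / 2)))‖ := by
        congr 1; ring
    _ ≤ 2 * (|θ| * (q * (1 - q) * θ ^ 2)) := (norm_add_le _ _).trans (by linarith)
    _ ≤ _ := by nlinarith

lemma norm_prod_sub_prod_le_sum {ι : Type*} (s : Finset ι) (f g : ι → ℂ)
    (hf : ∀ i ∈ s, ‖f i‖ ≤ 1) (hg : ∀ i ∈ s, ‖g i‖ ≤ 1) :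
    ‖∏ i ∈ s, f i - ∏ i ∈ s, g i‖ ≤ ∑ i ∈ s, ‖f i - g i‖ := by
  induction s using Finset.induction_on with
  | empty => simp
  | insert a s ha ih =>
    rw [Finset.prod_insert ha, Finset.prod_insert ha, Finset.sum_insert ha]
    have hprod : ‖∏ i ∈ s, f i‖ ≤ 1 := by
      rw [norm_prod]
      exact Finset.prod_le_one (fun i _ => norm_nonneg _)
        fun i hi => hf i (Finset.mem_insert_of_mem hi)
    have hle := ih (fun i hi => hf i (Finset.mem_insert_of_mem hi))
      fun i hi => hg i (Finset.mem_insert_of_mem hi)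
    have hga := hg a (Finset.mem_insert_self a s)
    calc _ = ‖(f a - g a) * ∏ i ∈ s, f i + g a * (∏ i ∈ s, f i - ∏ i ∈ s, g i)‖ := by
          congr 1; ring
      _ ≤ ‖f a - g a‖ * ‖∏ i ∈ s, f i‖ + ‖g a‖ * ‖∏ i ∈ s, f i - ∏ i ∈ s, g i‖ := by
          refine (norm_add_le _ _).trans ?_
          rw [norm_mul, norm_mul]
      _ ≤ _ := add_le_add (mul_le_of_le_one_right (norm_nonneg _) hprod)
          ((mul_le_of_le_one_left (norm_nonneg _) hga).trans hle)

/-- A Lindeberg-type estimate for weighted sums of centred Bernoulli variables. -/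
lemma norm_prod_centredBernoulliChar_sub_exp_le {ι : Type*} [Fintype ι] {q ε : ℝ} (hq0 : 0 ≤ q)
    (hq1 : q ≤ 1) (hε0 : 0 ≤ ε) (hε : ε ≤ 1) (θ : ι → ℝ) :
    ‖∏ j, centredBernoulliChar q (θ j) - Real.exp (-(q * (1 - q) * ∑ j, θ j ^ 2) / 2)‖ ≤
      2 * ε * (q * (1 - q) * ∑ j, θ j ^ 2) +
        4 * (q * (1 - q) * ∑ j, if ε < |θ j| then θ j ^ 2 else 0) := by
  have h1q := sub_nonneg.2 hq1
  have hexp : ((Real.exp (-(q * (1 - q) * ∑ j, θ j ^ 2) / 2) : ℝ) : ℂ) =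
      ∏ j, ((Real.exp (-(q * (1 - q) * θ j ^ 2 / 2)) : ℝ) : ℂ) := by
    rw [← Complex.ofReal_prod, ← Real.exp_sum, Finset.sum_neg_distrib, ← Finset.sum_div,
      ← Finset.mul_sum, neg_div]
  rw [hexp]
  refine (norm_prod_sub_prod_le_sum _ _ _
    (fun j _ => norm_centredBernoulliChar_le_one hq0 hq1 (θ j)) fun j _ => ?_).trans ?_
  · rw [Complex.norm_real, Real.norm_of_nonneg (Real.exp_pos _).le, Real.exp_le_one_iff]
    have : 0 ≤ q * (1 - q) * θ j ^ 2 := by positivity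
    linarith
  · rw [Finset.mul_sum, Finset.mul_sum, Finset.mul_sum, Finset.mul_sum, ← Finset.sum_add_distrib]
    refine Finset.sum_le_sum fun j _ => ?_
    have hv : 0 ≤ q * (1 - q) * θ j ^ 2 := by positivity
    split_ifs with h
    · have := norm_centredBernoulliChar_sub_exp_le hq0 hq1 (θ j)
      nlinarith
    · have := norm_centredBernoulliChar_sub_exp_le_of_abs_le hq0 hq1 hε (not_lt.1 h)
      linarith

lemma norm_exp_I_mul_sub_one_sq (x : ℝ) :
    ‖Complex.exp (Complex.I * x) - 1‖ ^ 2 = 2 * (1 - Real.cos x) := by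
  rw [Complex.norm_exp_I_mul_ofReal_sub_one, Real.norm_eq_abs, sq_abs, mul_pow,
    Real.sin_sq_eq_half_sub]
  ring_nf

lemma two_div_pi_mul_abs_le_norm_exp_sub_one {x : ℝ} (hx : |x| ≤ Real.pi) :
    2 / Real.pi * |x| ≤ ‖Complex.exp (Complex.I * x) - 1‖ := by
  have h := Real.mul_abs_le_abs_sin (x := x / 2) (by rw [abs_div, abs_two]; linarith)
  rw [Complex.norm_exp_I_mul_ofReal_sub_one, norm_mul, Real.norm_eq_abs, Real.norm_eq_abs, abs_two]
  rw [abs_div, abs_two] at h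
  linarith

lemma norm_exp_add_sub_one_le (x y : ℝ) :
    ‖Complex.exp (Complex.I * (x + y : ℝ)) - 1‖ ≤
      ‖Complex.exp (Complex.I * x) - 1‖ + ‖Complex.exp (Complex.I * y) - 1‖ := by
  have e : Complex.exp (Complex.I * (x + y : ℝ)) - 1 =
      Complex.exp (Complex.I * x) * (Complex.exp (Complex.I * y) - 1) +
        (Complex.exp (Complex.I * x) - 1) := by
    rw [Complex.ofReal_add, mul_add, Complex.exp_add]
    ring
  rw [e, add_comm]
  refine (norm_add_le _ _).trans_eq ?_
  rw [norm_mul, Complex.norm_exp_I_mul_ofReal, one_mul, add_comm, add_comm]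

lemma norm_exp_neg_sub_one (x : ℝ) :
    ‖Complex.exp (Complex.I * (-x : ℝ)) - 1‖ = ‖Complex.exp (Complex.I * x) - 1‖ := by
  rw [Complex.norm_exp_I_mul_ofReal_sub_one, Complex.norm_exp_I_mul_ofReal_sub_one, neg_div,
    Real.sin_neg, mul_neg, norm_neg]

/-- For a nonlattice distribution, finitely many atoms `k` control `t` through the phases
`s + t * k`, uniformly in `s`. -/
lemma NonlatticeZ.exists_finset_norm_exp_le {p : ℤ → ℝ} (hp : NonlatticeZ p) :
    ∃ K : Finset ℤ, (∀ k ∈ K, 0 < p k) ∧ ∃ M : ℝ, 0 ≤ M ∧ ∀ s t : ℝ,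
      ‖Complex.exp (Complex.I * (t : ℝ)) - 1‖ ≤
        M * ∑ k ∈ K, ‖Complex.exp (Complex.I * (s + t * k : ℝ)) - 1‖ := by
  let D : Set ℤ := {z | ∃ i j, 0 < p i ∧ 0 < p j ∧ z = i - j}
  have hone : (1 : ℤ) ∈ AddSubgroup.closure D := by
    obtain ⟨g, hg⟩ := Int.subgroup_cyclic (AddSubgroup.closure D)
    have h1 := hp g.natAbs fun i j hi hj => by
      have : i - j ∈ AddSubgroup.closure D := AddSubgroup.subset_closure ⟨i, j, hi, hj, rfl⟩
      rw [hg, AddSubgroup.mem_closure_singleton] at this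
      obtain ⟨c, hc⟩ := this
      rw [Int.natAbs_dvd]
      exact ⟨c, by rw [← hc, smul_eq_mul, mul_comm]⟩
    rw [hg, AddSubgroup.mem_closure_singleton]
    rcases Int.natAbs_eq g with h | h
    · exact ⟨1, by rw [h, h1]; simp⟩
    · exact ⟨-1, by rw [h, h1]; simp⟩
  suffices H : ∀ z ∈ AddSubgroup.closure D, ∃ K : Finset ℤ, (∀ k ∈ K, 0 < p k) ∧ ∃ M : ℝ, 0 ≤ M ∧
      ∀ s t : ℝ, ‖Complex.exp (Complex.I * (t * z : ℝ)) - 1‖ ≤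
        M * ∑ k ∈ K, ‖Complex.exp (Complex.I * (s + t * k : ℝ)) - 1‖ by
    obtain ⟨K, hK, M, hM0, hM⟩ := H 1 hone
    exact ⟨K, hK, M, hM0, fun s t => by simpa using hM s t⟩
  intro z hz
  induction hz using AddSubgroup.closure_induction with
  | mem z hz =>
    obtain ⟨i, j, hi, hj, rfl⟩ := hz
    refine ⟨{i, j}, by simp [hi, hj], 2, by norm_num, fun s t => ?_⟩
    have hi' : ‖Complex.exp (Complex.I * (s + t * i : ℝ)) - 1‖ ≤
        ∑ k ∈ ({i, j} : Finset ℤ), ‖Complex.exp (Complex.I * (s + t * k : ℝ)) - 1‖ :=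
      Finset.single_le_sum (f := fun k : ℤ => ‖Complex.exp (Complex.I * (s + t * k : ℝ)) - 1‖)
        (fun _ _ => norm_nonneg _) (by simp)
    have hj' : ‖Complex.exp (Complex.I * (s + t * j : ℝ)) - 1‖ ≤
        ∑ k ∈ ({i, j} : Finset ℤ), ‖Complex.exp (Complex.I * (s + t * k : ℝ)) - 1‖ :=
      Finset.single_le_sum (f := fun k : ℤ => ‖Complex.exp (Complex.I * (s + t * k : ℝ)) - 1‖)
        (fun _ _ => norm_nonneg _) (by simp)
    have h := norm_exp_add_sub_one_le (s + t * i) (-(s + t * j))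
    rw [norm_exp_neg_sub_one] at h
    have e : t * ((i - j : ℤ) : ℝ) = s + t * i + -(s + t * j) := by push_cast; ring
    rw [e]
    linarith
  | zero => exact ⟨∅, by simp, 0, le_rfl, fun s t => by simp⟩
  | add x y _ _ hx hy =>
    obtain ⟨K, hK, M, hM0, hM⟩ := hx
    obtain ⟨L, hL, N, hN0, hN⟩ := hy
    refine ⟨K ∪ L, fun k hk => (Finset.mem_union.1 hk).elim (hK k) (hL k), M + N,
      add_nonneg hM0 hN0, fun s t => ?_⟩
    have e : t * ((x + y : ℤ) : ℝ) = t * x + t * y := by push_cast; ring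
    rw [e, add_mul]
    refine (norm_exp_add_sub_one_le _ _).trans (add_le_add ((hM s t).trans ?_) ((hN s t).trans ?_))
    · exact mul_le_mul_of_nonneg_left (Finset.sum_le_sum_of_subset_of_nonneg
        Finset.subset_union_left fun _ _ _ => norm_nonneg _) hM0
    · exact mul_le_mul_of_nonneg_left (Finset.sum_le_sum_of_subset_of_nonneg
        Finset.subset_union_right fun _ _ _ => norm_nonneg _) hN0
  | neg x _ hx =>
    obtain ⟨K, hK, M, hM0, hM⟩ := hx
    refine ⟨K, hK, M, hM0, fun s t => ?_⟩
    have e : t * ((-x : ℤ) : ℝ) = -(t * x) := by push_cast; ring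
    rw [e, norm_exp_neg_sub_one]
    exact hM s t

lemma sum_ge_sum_empFreq {n : ℕ} (d : Fin n → ℤ) (K : Finset ℤ) {f : ℤ → ℝ} (hf : ∀ k, 0 ≤ f k)
    {η : ℝ} (hη : ∀ k ∈ K, η ≤ empFreq d k) :
    η * n * ∑ k ∈ K, f k ≤ ∑ j, f (d j) := by
  have h1 : ∑ k ∈ K, ∑ j ∈ Finset.univ.filter (fun j => d j = k), f (d j) ≤ ∑ j, f (d j) := by
    exact Finset.sum_fiberwise_le_sum_of_sum_fiber_nonneg
      fun _ _ => Finset.sum_nonneg fun _ _ => hf _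
  refine le_trans ?_ h1
  rw [Finset.mul_sum]
  refine Finset.sum_le_sum fun k hk => ?_
  have h2 : ∑ j ∈ Finset.univ.filter (fun j => d j = k), f (d j) =
      ((Finset.univ.filter (fun j => d j = k)).card : ℝ) * f k := by
    rw [← nsmul_eq_mul, ← Finset.sum_const]
    exact Finset.sum_congr rfl fun j hj => by rw [(Finset.mem_filter.1 hj).2]
  rw [h2]
  refine mul_le_mul_of_nonneg_right ?_ (hf k)
  rcases Nat.eq_zero_or_pos n with hn | hn
  · subst hn
    simp
  · have hn' : (0 : ℝ) < n := by exact_mod_cast hn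
    have := hη k hk
    rwa [empFreq, le_div_iff₀ hn'] at this

lemma mul_sq_add_sq_le_sum_one_sub_cos {n : ℕ} (d : Fin n → ℤ) {K : Finset ℤ} {M R η b : ℝ}
    (hM0 : 0 ≤ M) (hM : ∀ s t : ℝ, ‖Complex.exp (Complex.I * (t : ℝ)) - 1‖ ≤
        M * ∑ k ∈ K, ‖Complex.exp (Complex.I * (s + t * k : ℝ)) - 1‖)
    {k₀ : ℤ} (hk₀ : k₀ ∈ K) (hR : |k₀ - b| ≤ R) (hη0 : 0 ≤ η)
    (hη : ∀ k ∈ K, η ≤ empFreq d k) {s t : ℝ} (hs : |s| ≤ Real.pi) (ht : |t| ≤ Real.pi) :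
    η * n * (s ^ 2 + t ^ 2) ≤
      2 * (((Real.pi / 2 * M) ^ 2 + (Real.pi / 2 * (1 + Real.pi / 2 * M * R)) ^ 2) * K.card) *
        ∑ j, (1 - Real.cos (s + t * (d j - b))) := by
  have hpi := Real.pi_pos
  set g : ℤ → ℝ := fun k => ‖Complex.exp (Complex.I * (s - t * b + t * k : ℝ)) - 1‖ with hg
  set S := ∑ k ∈ K, g k with hS
  have hg0 : ∀ k, 0 ≤ g k := fun k => norm_nonneg _
  have hS0 : 0 ≤ S := Finset.sum_nonneg fun k _ => hg0 k
  have hR0 : 0 ≤ R := (abs_nonneg _).trans hR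
  have ht' : |t| ≤ Real.pi / 2 * M * S := by
    have h1 := (two_div_pi_mul_abs_le_norm_exp_sub_one ht).trans (hM (s - t * b) t)
    have h2 := mul_le_mul_of_nonneg_left h1 (by positivity : 0 ≤ Real.pi / 2)
    calc |t| = Real.pi / 2 * (2 / Real.pi * |t|) := by field_simp
      _ ≤ _ := h2
      _ = _ := by rw [hS]; ring
  have hs' : |s| ≤ Real.pi / 2 * (1 + Real.pi / 2 * M * R) * S := by
    have h1 := two_div_pi_mul_abs_le_norm_exp_sub_one hs
    have h3 := norm_exp_add_sub_one_le (s - t * b + t * k₀) (-(t * (k₀ - b)))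
    rw [show s - t * b + t * k₀ + -(t * (k₀ - b)) = s by ring] at h3
    have h4 : ‖Complex.exp (Complex.I * (-(t * (k₀ - b)) : ℝ)) - 1‖ ≤ |t| * R := by
      refine Real.norm_exp_I_mul_ofReal_sub_one_le.trans ?_
      rw [Real.norm_eq_abs, abs_neg, abs_mul]
      exact mul_le_mul_of_nonneg_left hR (abs_nonneg t)
    have h5 : g k₀ ≤ S := Finset.single_le_sum (fun k _ => hg0 k) hk₀
    have h6 : 2 / Real.pi * |s| ≤ S + Real.pi / 2 * M * S * R := by
      have := mul_le_mul_of_nonneg_right ht' hR0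
      linarith
    have h2 := mul_le_mul_of_nonneg_left h6 (by positivity : 0 ≤ Real.pi / 2)
    calc |s| = Real.pi / 2 * (2 / Real.pi * |s|) := by field_simp
      _ ≤ _ := h2
      _ = _ := by ring
  have hsq : S ^ 2 ≤ K.card * ∑ k ∈ K, g k ^ 2 := sq_sum_le_card_mul_sum_sq
  have hsum := sum_ge_sum_empFreq d K (f := fun k => g k ^ 2) (fun k => sq_nonneg _) hη
  have hcos : ∑ j, g (d j) ^ 2 = 2 * ∑ j, (1 - Real.cos (s + t * (d j - b))) := by
    rw [Finset.mul_sum]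
    refine Finset.sum_congr rfl fun j _ => ?_
    rw [hg, norm_exp_I_mul_sub_one_sq]
    congr 3
    ring
  have hA : 0 ≤ Real.pi / 2 * M := by positivity
  have hB : 0 ≤ Real.pi / 2 * (1 + Real.pi / 2 * M * R) := by positivity
  have hst : s ^ 2 + t ^ 2 ≤
      ((Real.pi / 2 * M) ^ 2 + (Real.pi / 2 * (1 + Real.pi / 2 * M * R)) ^ 2) * S ^ 2 := by
    have h1 := pow_le_pow_left₀ (abs_nonneg t) ht' 2
    have h2 := pow_le_pow_left₀ (abs_nonneg s) hs' 2
    rw [sq_abs, mul_pow] at h1 h2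
    linarith
  set C := (Real.pi / 2 * M) ^ 2 + (Real.pi / 2 * (1 + Real.pi / 2 * M * R)) ^ 2
  have hC0 : 0 ≤ C := by positivity
  calc η * n * (s ^ 2 + t ^ 2) ≤ η * n * (C * (K.card * ∑ k ∈ K, g k ^ 2)) := by
        gcongr
        exact hst.trans (by gcongr)
    _ = C * K.card * (η * n * ∑ k ∈ K, g k ^ 2) := by ring
    _ ≤ C * K.card * (2 * ∑ j, (1 - Real.cos (s + t * (d j - b)))) := by
        rw [← hcos]
        gcongr
    _ = _ := by ring

lemma exists_eventually_mul_sq_add_sq_le {nn : ℕ → ℕ} {d : ∀ κ, Fin (nn κ) → ℤ} {p : ℤ → ℝ}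
    {C : ℝ} (hninf : Tendsto nn atTop atTop) (hnl : NonlatticeZ p)
    (hemp : ∀ k : ℤ, Tendsto (fun κ => empFreq (d κ) k) atTop (𝓝 (p k)))
    (hQ : ∀ κ, Qval (d κ) ≤ C * (nn κ : ℝ)) :
    ∃ c > 0, ∀ᶠ κ in atTop, ∀ s t : ℝ, |s| ≤ Real.pi → |t| ≤ Real.pi →
      c * nn κ * (s ^ 2 + t ^ 2) ≤
        ∑ j, (1 - Real.cos (s + t * (d κ j - dbar (d κ)))) := by
  obtain ⟨K, hK, M, hM0, hM⟩ := hnl.exists_finset_norm_exp_le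
  have hKne : K.Nonempty := by
    rw [Finset.nonempty_iff_ne_empty]
    rintro rfl
    have h1 := hM 0 Real.pi
    rw [mul_comm Complex.I, Complex.exp_pi_mul_I] at h1
    norm_num at h1
  obtain ⟨η, hη0, hη⟩ : ∃ η > 0, ∀ k ∈ K, η < p k := by
    obtain ⟨k₁, hk₁, hmin⟩ := K.exists_min_image p hKne
    exact ⟨p k₁ / 2, half_pos (hK k₁ hk₁), fun k hk =>
      (half_lt_self (hK k₁ hk₁)).trans_le (hmin k hk)⟩
  obtain ⟨k₀, hk₀⟩ := hKne
  have hη' : ∀ᶠ κ in atTop, ∀ k ∈ K, η ≤ empFreq (d κ) k := by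
    rw [Filter.eventually_all_finset]
    exact fun k hk => ((hemp k).eventually_const_lt (hη k hk)).mono fun κ h => h.le
  set R := √(C / η)
  set B := 2 * (((Real.pi / 2 * M) ^ 2 + (Real.pi / 2 * (1 + Real.pi / 2 * M * R)) ^ 2) *
    (K.card : ℝ))
  have hBpos : 0 < B := by
    have : (0 : ℝ) < K.card := by exact_mod_cast Finset.card_pos.2 ⟨k₀, hk₀⟩
    have := Real.pi_pos
    have hR0 : 0 ≤ R := Real.sqrt_nonneg _
    positivity
  refine ⟨η / B, div_pos hη0 hBpos, ?_⟩
  filter_upwards [hη', hninf.eventually_gt_atTop 0] with κ h hn s t hs ht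
  have hn' : (0 : ℝ) < nn κ := by exact_mod_cast hn
  have hb : |k₀ - dbar (d κ)| ≤ R := by
    refine Real.abs_le_sqrt ?_
    have h1 := sum_ge_sum_empFreq (d κ) {k₀} (f := fun k => (k - dbar (d κ)) ^ 2)
      (fun k => sq_nonneg _) (η := η) (by simpa using h k₀ hk₀)
    rw [Finset.sum_singleton] at h1
    have h2 := h1.trans (hQ κ)
    rw [le_div_iff₀ hη0]
    nlinarith
  have := mul_sq_add_sq_le_sum_one_sub_cos (d κ) hM0 hM hk₀ hb hη0.le h hs ht
  rw [div_mul_eq_mul_div, div_mul_eq_mul_div, div_le_iff₀ hBpos]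
  exact this.trans_eq (mul_comm _ _)

/-- The joint characteristic function, at `(s, t)`, of the centred sums `∑ (ξ_j - q)` and
`∑ (ξ_j - q) (d_j - d̄)` with independent Bernoulli variables `ξ_j` of parameter `q = m / n`. -/
noncomputable def bernoulliPairChar {n : ℕ} (d : Fin n → ℤ) (m : ℕ) (s t : ℝ) : ℂ :=
  ∏ j, centredBernoulliChar ((m : ℝ) / n) (s + t * (d j - dbar d))

lemma continuous_bernoulliPairChar {n : ℕ} (d : Fin n → ℤ) (m : ℕ) :
    Continuous fun z : ℝ × ℝ => bernoulliPairChar d m z.1 z.2 := by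
  unfold bernoulliPairChar
  exact continuous_finsetProd _ fun j _ =>
    (continuous_centredBernoulliChar _).comp (by fun_prop)

lemma sum_sub_dbar {n : ℕ} (d : Fin n → ℤ) : ∑ j, ((d j : ℝ) - dbar d) = 0 := by
  rcases Nat.eq_zero_or_pos n with hn | hn
  · subst hn
    simp
  · have hn' : (n : ℝ) ≠ 0 := by exact_mod_cast hn.ne'
    rw [Finset.sum_sub_distrib, Finset.sum_const, Finset.card_univ, Fintype.card_fin, nsmul_eq_mul,
      dbar]
    field_simp
    ring

lemma bernoulliPairChar_eq {n : ℕ} (hn : 0 < n) (d : Fin n → ℤ) (m : ℕ) (s t : ℝ) :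
    bernoulliPairChar d m s t = Complex.exp (Complex.I * (-(m * s) : ℝ)) *
      ∏ j, ((1 - ((m / n : ℝ) : ℂ)) + ((m / n : ℝ) : ℂ) *
        Complex.exp (Complex.I * ((s + t * (d j - dbar d) : ℝ) : ℂ))) := by
  have hn' : (n : ℝ) ≠ 0 := by exact_mod_cast hn.ne'
  simp only [bernoulliPairChar, centredBernoulliChar_eq]
  rw [Finset.prod_mul_distrib, ← Complex.exp_sum, ← Finset.mul_sum, ← Complex.ofReal_sum,
    ← Finset.mul_sum, Finset.sum_add_distrib, ← Finset.mul_sum, sum_sub_dbar, Finset.sum_const,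
    Finset.card_univ, Fintype.card_fin, nsmul_eq_mul]
  congr 4
  field_simp
  ring

open Finset in
lemma integral_integral_bernoulliPairChar {n : ℕ} (hn : 0 < n) (d : Fin n → ℤ) (m : ℕ) (k : ℤ) :
    ∫ t in (-Real.pi)..Real.pi, ∫ s in (-Real.pi)..Real.pi,
        Complex.exp (Complex.I * (-(k - m * dbar d) * t : ℝ)) * bernoulliPairChar d m s t =
      (2 * Real.pi) ^ 2 * (((m / n : ℝ) : ℂ) ^ m * (1 - ((m / n : ℝ) : ℂ)) ^ (n - m)) *
        #{A ∈ powersetCard m (univ : Finset (Fin n)) | ∑ i ∈ A, d i = k} := by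
  rw [← integral_integral_prod_bernoulli]
  refine intervalIntegral.integral_congr fun t _ => ?_
  set f : ℝ → ℂ := fun s => Complex.exp (-Complex.I * (m * s + k * t)) *
    ∏ j, ((1 - ((m / n : ℝ) : ℂ)) + ((m / n : ℝ) : ℂ) *
      Complex.exp (Complex.I * ((s + t * d j : ℝ) : ℂ))) with hf
  have hper : Function.Periodic f (2 * Real.pi) := by
    intro s
    simp only [hf]
    congr 1
    · rw [Complex.exp_eq_exp_iff_exists_int]
      exact ⟨-m, by push_cast; ring⟩
    · refine Finset.prod_congr rfl fun j _ => ?_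
      congr 2
      rw [Complex.exp_eq_exp_iff_exists_int]
      exact ⟨1, by push_cast; ring⟩
  have hshift : ∀ s : ℝ, Complex.exp (Complex.I * (-(k - m * dbar d) * t : ℝ)) *
      bernoulliPairChar d m s t = f (s - t * dbar d) := by
    intro s
    rw [bernoulliPairChar_eq hn, ← mul_assoc, ← Complex.exp_add]
    simp only [hf]
    congr 1
    · congr 1
      push_cast
      ring
    · refine Finset.prod_congr rfl fun j _ => ?_
      congr 4
      push_cast
      ring
  simp only [hshift]
  rw [intervalIntegral.integral_comp_sub_right]
  have h := hper.intervalIntegral_add_eq (-Real.pi - t * dbar d) (-Real.pi)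
  rw [show -Real.pi - t * dbar d + 2 * Real.pi = Real.pi - t * dbar d by ring,
    show -Real.pi + 2 * Real.pi = Real.pi by ring] at h
  exact h

lemma integral_bernoulliPairChar_zero {n : ℕ} (hn : 0 < n) (d : Fin n → ℤ) (m : ℕ) :
    ∫ s in (-Real.pi)..Real.pi, bernoulliPairChar d m s 0 =
      2 * Real.pi * (((m / n : ℝ) : ℂ) ^ m * (1 - ((m / n : ℝ) : ℂ)) ^ (n - m)) *
        n.choose m := by
  rw [← integral_bernoulli_pow]
  refine intervalIntegral.integral_congr fun s _ => ?_
  simp only [bernoulliPairChar_eq hn, zero_mul, add_zero, Finset.prod_const, Finset.card_univ,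
    Fintype.card_fin]
  congr 2
  push_cast
  ring

lemma integral_exp_neg_sq_div_two : ∫ u : ℝ, Real.exp (-u ^ 2 / 2) = √(2 * Real.pi) := by
  have h := integral_gaussian (1 / 2)
  rw [show Real.pi / (1 / 2) = 2 * Real.pi by ring] at h
  rw [← h]
  congr 1 with u
  congr 1
  ring

lemma integrable_exp_neg_sq_div_two : Integrable fun u : ℝ => Real.exp (-u ^ 2 / 2) := by
  refine (integrable_exp_neg_mul_sq (b := 1 / 2) (by norm_num)).congr ?_
  refine Filter.Eventually.of_forall fun u => ?_
  simp only
  congr 1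
  ring

lemma integral_exp_I_mul_exp_neg_sq_div_two (y : ℝ) :
    ∫ v : ℝ, Complex.exp (Complex.I * (-y * v : ℝ)) * (Real.exp (-v ^ 2 / 2) : ℝ) =
      (√(2 * Real.pi) * Real.exp (-y ^ 2 / 2) : ℝ) := by
  have h := fourierIntegral_gaussian (b := 1 / 2) (by norm_num) (-(y : ℂ))
  have hpi : ((Real.pi : ℂ) / (1 / 2)) ^ (1 / 2 : ℂ) = (√(2 * Real.pi) : ℝ) := by
    rw [Real.sqrt_eq_rpow, Complex.ofReal_cpow (by positivity)]
    congr 1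
    · push_cast; ring
    · norm_num
  rw [hpi] at h
  rw [Complex.ofReal_mul, Complex.ofReal_exp]
  convert h using 2
  · ext v
    rw [Complex.ofReal_exp]
    congr 2
    · push_cast; ring
    · push_cast; ring
  · congr 1
    push_cast
    ring

lemma integral_integral_eq_integral_indicator {F : ℝ → ℝ → ℂ}
    (hF : Continuous fun z : ℝ × ℝ => F z.1 z.2) {σ a : ℝ} (hσ : 0 < σ) (ha : 0 < a) :
    ∫ z : ℝ × ℝ, (Set.Icc (-Real.pi * σ) (Real.pi * σ) ×ˢ
        Set.Icc (-Real.pi * a) (Real.pi * a)).indicator (fun z => F (z.1 / σ) (z.2 / a)) z =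
      (σ * a : ℝ) * ∫ t in (-Real.pi)..Real.pi, ∫ s in (-Real.pi)..Real.pi, F t s := by
  have hpi := Real.pi_pos
  have hc : Continuous fun z : ℝ × ℝ => F (z.1 / σ) (z.2 / a) :=
    hF.comp (f := fun z : ℝ × ℝ => (z.1 / σ, z.2 / a)) (by fun_prop)
  rw [integral_indicator (measurableSet_Icc.prod measurableSet_Icc), Measure.volume_eq_prod,
    setIntegral_prod _ (hc.continuousOn.integrableOn_compact (isCompact_Icc.prod isCompact_Icc))]
  have hint : ∀ {c : ℝ}, 0 < c → ∀ g : ℝ → ℂ, ∫ x in Set.Icc (-Real.pi * c) (Real.pi * c),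
      g (x / c) = (c : ℂ) * ∫ x in (-Real.pi)..Real.pi, g x := by
    intro c hc g
    rw [integral_Icc_eq_integral_Ioc,
      ← intervalIntegral.integral_of_le (by nlinarith [mul_pos hpi hc]),
      intervalIntegral.integral_comp_div _ hc.ne', mul_div_cancel_right₀ _ hc.ne',
      mul_div_cancel_right₀ _ hc.ne', Complex.real_smul]
  rw [hint hσ fun v => ∫ u in Set.Icc (-Real.pi * a) (Real.pi * a), F v (u / a)]
  simp only [hint ha]
  rw [intervalIntegral.integral_const_mul]
  push_cast
  ring

lemma integral_eq_integral_indicator (F : ℝ → ℂ) {a : ℝ} (ha : 0 < a) :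
    ∫ u : ℝ, (Set.Icc (-Real.pi * a) (Real.pi * a)).indicator (fun u => F (u / a)) u =
      (a : ℂ) * ∫ s in (-Real.pi)..Real.pi, F s := by
  have hpi := Real.pi_pos
  rw [integral_indicator measurableSet_Icc, integral_Icc_eq_integral_Ioc,
    ← intervalIntegral.integral_of_le (by nlinarith [mul_pos hpi ha]),
    intervalIntegral.integral_comp_div _ ha.ne', mul_div_cancel_right₀ _ ha.ne',
    mul_div_cancel_right₀ _ ha.ne', Complex.real_smul]

/-- The rescaled joint characteristic function, cut off outside one period. -/
noncomputable def scaledPairChar {n : ℕ} (d : Fin n → ℤ) (m : ℕ) (σ a : ℝ) : ℝ × ℝ → ℂ :=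
  (Set.Icc (-Real.pi * σ) (Real.pi * σ) ×ˢ Set.Icc (-Real.pi * a) (Real.pi * a)).indicator
    fun z => bernoulliPairChar d m (z.2 / a) (z.1 / σ)

/-- The probability that a binomial variable with parameters `n` and `m / n` equals `m`. -/
noncomputable def binomialMass (n m : ℕ) : ℝ :=
  ((m : ℝ) / n) ^ m * (1 - (m : ℝ) / n) ^ (n - m) * n.choose m

/-- The unnormalized standard Gaussian density on the plane. -/
noncomputable def planarGaussian (z : ℝ × ℝ) : ℂ :=
  (Real.exp (-z.1 ^ 2 / 2) : ℝ) * (Real.exp (-z.2 ^ 2 / 2) : ℝ)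

lemma integrable_planarGaussian : Integrable planarGaussian :=
  Integrable.mul_prod (f := fun u : ℝ => ((Real.exp (-u ^ 2 / 2) : ℝ) : ℂ))
    (g := fun u : ℝ => ((Real.exp (-u ^ 2 / 2) : ℝ) : ℂ))
    integrable_exp_neg_sq_div_two.ofReal integrable_exp_neg_sq_div_two.ofReal

lemma integrable_scaledPairChar {n : ℕ} (d : Fin n → ℤ) (m : ℕ) (σ a : ℝ) :
    Integrable (scaledPairChar d m σ a) := by
  have hc : Continuous fun z : ℝ × ℝ => bernoulliPairChar d m (z.2 / a) (z.1 / σ) :=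
    (continuous_bernoulliPairChar d m).comp (f := fun z : ℝ × ℝ => (z.2 / a, z.1 / σ))
      (by fun_prop)
  exact (integrable_indicator_iff (measurableSet_Icc.prod measurableSet_Icc)).2
    (hc.continuousOn.integrableOn_compact (isCompact_Icc.prod isCompact_Icc))

lemma norm_integral_exp_mul_le {f : ℝ × ℝ → ℂ} (y : ℝ) :
    ‖∫ z : ℝ × ℝ, Complex.exp (Complex.I * (-y * z.1 : ℝ)) * f z‖ ≤ ∫ z : ℝ × ℝ, ‖f z‖ := by
  refine (norm_integral_le_integral_norm _).trans_eq ?_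
  simp only [norm_mul, Complex.norm_exp_I_mul_ofReal, one_mul]

lemma abs_probPerm_sub_exp_le {n m : ℕ} (hn : 0 < n) (hm : m ≤ n) (d : Fin n → ℤ) (k : ℤ)
    {σ a : ℝ} (hσ : 0 < σ) (ha : 0 < a) :
    |σ * a * (2 * Real.pi) ^ 2 * binomialMass n m * probPerm (fun τ => sampleSum d m τ = k) -
        2 * Real.pi * Real.exp (-((k - m * dbar d) / σ) ^ 2 / 2)| ≤
      ∫ z : ℝ × ℝ, ‖scaledPairChar d m σ a z - planarGaussian z‖ := by
  set y := (k - m * dbar d) / σ with hy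
  have h1 : ∫ z : ℝ × ℝ, Complex.exp (Complex.I * (-y * z.1 : ℝ)) * scaledPairChar d m σ a z =
      ((σ * a * (2 * Real.pi) ^ 2 * binomialMass n m *
        probPerm (fun τ => sampleSum d m τ = k) : ℝ) : ℂ) := by
    have hcont : Continuous fun z : ℝ × ℝ =>
        Complex.exp (Complex.I * (-(k - m * dbar d) * z.1 : ℝ)) *
          bernoulliPairChar d m z.2 z.1 :=
      Continuous.mul (by fun_prop) ((continuous_bernoulliPairChar d m).comp
        (f := fun z : ℝ × ℝ => (z.2, z.1)) (by fun_prop))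
    have h := integral_integral_eq_integral_indicator (F := fun t s =>
      Complex.exp (Complex.I * (-(k - m * dbar d) * t : ℝ)) * bernoulliPairChar d m s t)
      hcont hσ ha
    rw [integral_integral_bernoulliPairChar hn] at h
    have hchoose : (((Finset.powersetCard m (Finset.univ : Finset (Fin n))).filter
        fun A => ∑ i ∈ A, d i = k).card : ℂ) =
        ((probPerm (fun τ => sampleSum d m τ = k) * n.choose m : ℝ) : ℂ) := by
      rw [probPerm_sampleSum_mul_choose hm]
      simp
    rw [hchoose] at h
    refine Eq.trans ?_ (h.trans ?_)
    · congr 1 with z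
      rw [scaledPairChar]
      by_cases hz : z ∈ Set.Icc (-Real.pi * σ) (Real.pi * σ) ×ˢ
        Set.Icc (-Real.pi * a) (Real.pi * a)
      · rw [Set.indicator_of_mem hz, Set.indicator_of_mem hz, hy]
        congr 3
        push_cast
        ring
      · rw [Set.indicator_of_notMem hz, Set.indicator_of_notMem hz, mul_zero]
    · rw [binomialMass]
      push_cast
      ring
  have h2 : ∫ z : ℝ × ℝ, Complex.exp (Complex.I * (-y * z.1 : ℝ)) * planarGaussian z =
      ((2 * Real.pi * Real.exp (-y ^ 2 / 2) : ℝ) : ℂ) := by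
    simp only [planarGaussian, ← mul_assoc]
    rw [Measure.volume_eq_prod, integral_prod_mul (fun v : ℝ =>
      Complex.exp (Complex.I * (-y * v : ℝ)) * ((Real.exp (-v ^ 2 / 2) : ℝ) : ℂ))
      (fun u : ℝ => ((Real.exp (-u ^ 2 / 2) : ℝ) : ℂ)), integral_exp_I_mul_exp_neg_sq_div_two,
      integral_complex_ofReal, integral_exp_neg_sq_div_two, ← Complex.ofReal_mul]
    congr 1
    have := Real.mul_self_sqrt (show 0 ≤ 2 * Real.pi by positivity)
    linear_combination Real.exp (-y ^ 2 / 2) * this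
  have hbdd : ∀ {f : ℝ × ℝ → ℂ}, Integrable f →
      Integrable fun z : ℝ × ℝ => Complex.exp (Complex.I * (-y * z.1 : ℝ)) * f z := by
    intro f hf
    refine hf.bdd_mul (c := 1) (Continuous.aestronglyMeasurable (by fun_prop)) ?_
    exact Filter.Eventually.of_forall fun z => (Complex.norm_exp_I_mul_ofReal _).le
  rw [← Real.norm_eq_abs, ← Complex.norm_real, Complex.ofReal_sub, ← h1, ← h2,
    ← integral_sub (hbdd (integrable_scaledPairChar d m σ a)) (hbdd integrable_planarGaussian)]
  simp only [← mul_sub]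
  exact norm_integral_exp_mul_le y

lemma abs_binomialMass_sub_le {n m : ℕ} (hn : 0 < n) (d : Fin n → ℤ) {σ a : ℝ} (hσ : 0 < σ)
    (ha : 0 < a) :
    |a * (2 * Real.pi) * binomialMass n m - √(2 * Real.pi)| ≤
      ∫ u : ℝ, ‖scaledPairChar d m σ a (0, u) - planarGaussian (0, u)‖ := by
  have hpi := Real.pi_pos
  have hind : ∀ u : ℝ, scaledPairChar d m σ a (0, u) =
      (Set.Icc (-Real.pi * a) (Real.pi * a)).indicator
        (fun u => bernoulliPairChar d m (u / a) 0) u := by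
    intro u
    have h0 : (0 : ℝ) ∈ Set.Icc (-Real.pi * σ) (Real.pi * σ) := by
      constructor <;> nlinarith [mul_pos hpi hσ]
    rw [scaledPairChar]
    by_cases hu : u ∈ Set.Icc (-Real.pi * a) (Real.pi * a)
    · rw [Set.indicator_of_mem hu, Set.indicator_of_mem (Set.mk_mem_prod h0 hu), zero_div]
    · rw [Set.indicator_of_notMem hu, Set.indicator_of_notMem fun h => hu h.2]
  have h1 : ∫ u : ℝ, scaledPairChar d m σ a (0, u) =
      ((a * (2 * Real.pi) * binomialMass n m : ℝ) : ℂ) := by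
    simp only [hind]
    rw [integral_eq_integral_indicator (fun s => bernoulliPairChar d m s 0) ha,
      integral_bernoulliPairChar_zero hn, binomialMass]
    push_cast
    ring
  have hg : ∀ u : ℝ, planarGaussian (0, u) = ((Real.exp (-u ^ 2 / 2) : ℝ) : ℂ) := by
    intro u
    simp [planarGaussian]
  have h2 : ∫ u : ℝ, planarGaussian (0, u) = (√(2 * Real.pi) : ℝ) := by
    simp only [hg]
    rw [integral_complex_ofReal, integral_exp_neg_sq_div_two]
  have hi1 : Integrable fun u : ℝ => scaledPairChar d m σ a (0, u) := by
    simp only [hind]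
    have hc : Continuous fun u : ℝ => bernoulliPairChar d m (u / a) 0 :=
      (continuous_bernoulliPairChar d m).comp (f := fun u : ℝ => (u / a, (0 : ℝ))) (by fun_prop)
    exact (integrable_indicator_iff measurableSet_Icc).2
      (hc.continuousOn.integrableOn_compact isCompact_Icc)
  have hi2 : Integrable fun u : ℝ => planarGaussian (0, u) := by
    simp only [hg]
    exact integrable_exp_neg_sq_div_two.ofReal
  rw [← Real.norm_eq_abs, ← Complex.norm_real, Complex.ofReal_sub, ← h1, ← h2,
    ← integral_sub hi1 hi2]
  exact norm_integral_le_integral_norm _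

lemma Qval_nonneg {n : ℕ} (d : Fin n → ℤ) : 0 ≤ Qval d :=
  Finset.sum_nonneg fun _ _ => sq_nonneg _

lemma div_mem_Icc_of_le {n m : ℕ} (hm : m ≤ n) : 0 ≤ (m : ℝ) / n ∧ (m : ℝ) / n ≤ 1 :=
  ⟨by positivity, div_le_one_of_le₀ (by exact_mod_cast hm) (by positivity)⟩

lemma bernoulliVar_nonneg {n m : ℕ} (hm : m ≤ n) : 0 ≤ (m : ℝ) / n * (1 - (m : ℝ) / n) :=
  mul_nonneg (div_mem_Icc_of_le hm).1 (sub_nonneg.2 (div_mem_Icc_of_le hm).2)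

lemma sigHatSq_nonneg {n m : ℕ} (hm : m ≤ n) (d : Fin n → ℤ) : 0 ≤ sigHatSq d m :=
  mul_nonneg (bernoulliVar_nonneg hm) (Qval_nonneg d)

/-- The variance `n q (1 - q)` of a binomial variable with parameters `n` and `q = m / n`. -/
noncomputable def binomialVar (n m : ℕ) : ℝ := n * ((m : ℝ) / n * (1 - (m : ℝ) / n))

/-- The Lindeberg quotient with threshold `ε σ̂`. -/
noncomputable def lindebergQuotient {n : ℕ} (d : Fin n → ℤ) (m : ℕ) (ε : ℝ) : ℝ :=
  (Qval d)⁻¹ * ∑ i : Fin n,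
    if ε * Real.sqrt (sigHatSq d m) < |(d i : ℝ) - dbar d| then ((d i : ℝ) - dbar d) ^ 2 else 0

lemma bernoulliVar_mul_sum_sq {n m : ℕ} (d : Fin n → ℤ) (s t : ℝ) :
    (m : ℝ) / n * (1 - (m : ℝ) / n) * ∑ j, (s + t * (d j - dbar d)) ^ 2 =
      s ^ 2 * binomialVar n m + t ^ 2 * sigHatSq d m := by
  have h : ∑ j, (s + t * (d j - dbar d)) ^ 2 = n * s ^ 2 + t ^ 2 * Qval d := by
    have e : ∀ j, (s + t * (d j - dbar d)) ^ 2 =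
        s ^ 2 + 2 * s * t * (d j - dbar d) + t ^ 2 * (d j - dbar d) ^ 2 := fun j => by ring
    simp only [e]
    rw [Finset.sum_add_distrib, Finset.sum_add_distrib, ← Finset.mul_sum, ← Finset.mul_sum,
      sum_sub_dbar, Finset.sum_const, Finset.card_univ, Fintype.card_fin, nsmul_eq_mul, Qval]
    ring
  rw [h, binomialVar, sigHatSq]
  ring

lemma norm_bernoulliPairChar_sub_planarGaussian_le {n m : ℕ} (hm : m ≤ n) (d : Fin n → ℤ)
    (hσ : 0 < sigHatSq d m) (ha : 0 < binomialVar n m) {ε u v : ℝ} (hε0 : 0 < ε) (hε : ε ≤ 1)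
    (hu : |u / √(binomialVar n m)| ≤ ε / 2) :
    ‖bernoulliPairChar d m (u / √(binomialVar n m)) (v / √(sigHatSq d m)) -
        planarGaussian (v, u)‖ ≤
      2 * ε * (u ^ 2 + v ^ 2) + 16 * v ^ 2 * lindebergQuotient d m (ε / (2 * (|v| + 1))) := by
  set s := u / √(binomialVar n m) with hs
  set t := v / √(sigHatSq d m) with ht
  have hσ' := Real.sqrt_pos.2 hσ
  have hs2 : s ^ 2 * binomialVar n m = u ^ 2 := by
    rw [hs, div_pow, Real.sq_sqrt ha.le, div_mul_cancel₀ _ ha.ne']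
  have ht2 : t ^ 2 * sigHatSq d m = v ^ 2 := by
    rw [ht, div_pow, Real.sq_sqrt hσ.le, div_mul_cancel₀ _ hσ.ne']
  have hvar := bernoulliVar_mul_sum_sq (m := m) d s t
  rw [hs2, ht2] at hvar
  obtain ⟨hq0, hq1⟩ := div_mem_Icc_of_le hm
  have h := norm_prod_centredBernoulliChar_sub_exp_le hq0 hq1 hε0.le hε
    fun j => s + t * (d j - dbar d)
  rw [hvar] at h
  have hgauss : planarGaussian (v, u) = ((Real.exp (-(u ^ 2 + v ^ 2) / 2) : ℝ) : ℂ) := by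
    rw [planarGaussian, ← Complex.ofReal_mul, ← Real.exp_add]
    congr 2
    ring
  rw [hgauss]
  refine h.trans (add_le_add le_rfl ?_)
  have hterm : ∀ j, (if ε < |s + t * (d j - dbar d)| then (s + t * (d j - dbar d)) ^ 2 else 0) ≤
      4 * t ^ 2 * (if ε / (2 * (|v| + 1)) * √(sigHatSq d m) < |(d j : ℝ) - dbar d| then
        ((d j : ℝ) - dbar d) ^ 2 else 0) := by
    intro j
    split_ifs with h1 h2 h2
    · have h3 : |s + t * (d j - dbar d)| ≤ 2 * |t * (d j - dbar d)| := by
        linarith [abs_add_le s (t * (d j - dbar d))]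
      have h4 := pow_le_pow_left₀ (abs_nonneg _) h3 2
      rw [mul_pow, sq_abs, sq_abs] at h4
      nlinarith
    · exfalso
      have h3 := abs_add_le s (t * (d j - dbar d))
      have h4 : |t * (d j - dbar d)| ≤ ε / 2 := by
        rw [ht, abs_mul, abs_div, abs_of_pos hσ']
        calc |v| / √(sigHatSq d m) * |(d j : ℝ) - dbar d| ≤
            |v| / √(sigHatSq d m) * (ε / (2 * (|v| + 1)) * √(sigHatSq d m)) := by
              gcongr
              exact not_lt.1 h2
          _ = ε / 2 * (|v| / (|v| + 1)) := by field_simp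
          _ ≤ ε / 2 := by
              refine mul_le_of_le_one_right (by positivity) ?_
              rw [div_le_one (by positivity)]
              linarith
      linarith
    · positivity
    · simp
  have hQ : (m : ℝ) / n * (1 - (m : ℝ) / n) * t ^ 2 = v ^ 2 * (Qval d)⁻¹ := by
    have hQ0 : Qval d ≠ 0 := by
      intro h0
      rw [sigHatSq, h0, mul_zero] at hσ
      exact hσ.false
    rw [← ht2, sigHatSq]
    field_simp
  calc 4 * ((m : ℝ) / n * (1 - (m : ℝ) / n) *
        ∑ j, if ε < |s + t * (d j - dbar d)| then (s + t * (d j - dbar d)) ^ 2 else 0)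
      ≤ 4 * ((m : ℝ) / n * (1 - (m : ℝ) / n) * ∑ j, 4 * t ^ 2 *
          (if ε / (2 * (|v| + 1)) * √(sigHatSq d m) < |(d j : ℝ) - dbar d| then
            ((d j : ℝ) - dbar d) ^ 2 else 0)) := by
        refine mul_le_mul_of_nonneg_left (mul_le_mul_of_nonneg_left
          (Finset.sum_le_sum fun j _ => hterm j) (bernoulliVar_nonneg hm)) (by norm_num)
    _ = 16 * v ^ 2 * lindebergQuotient d m (ε / (2 * (|v| + 1))) := by
        rw [← Finset.mul_sum, lindebergQuotient]
        linear_combination 16 * (∑ j, if ε / (2 * (|v| + 1)) * √(sigHatSq d m) <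
          |(d j : ℝ) - dbar d| then ((d j : ℝ) - dbar d) ^ 2 else 0) * hQ

lemma norm_scaledPairChar_le {n m : ℕ} (hm : m ≤ n) (d : Fin n → ℤ) {c C : ℝ} (hc : 0 < c)
    (hC : 1 ≤ C) (hQ : Qval d ≤ C * n) (hσ : 0 < sigHatSq d m) (ha : 0 < binomialVar n m)
    (h : ∀ s t : ℝ, |s| ≤ Real.pi → |t| ≤ Real.pi →
      c * n * (s ^ 2 + t ^ 2) ≤ ∑ j, (1 - Real.cos (s + t * (d j - dbar d)))) (z : ℝ × ℝ) :
    ‖scaledPairChar d m √(sigHatSq d m) √(binomialVar n m) z‖ ≤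
      Real.exp (-(c / C) * z.1 ^ 2) * Real.exp (-(c / C) * z.2 ^ 2) := by
  by_cases hz : z ∈ Set.Icc (-Real.pi * √(sigHatSq d m)) (Real.pi * √(sigHatSq d m)) ×ˢ
    Set.Icc (-Real.pi * √(binomialVar n m)) (Real.pi * √(binomialVar n m))
  · rw [scaledPairChar, Set.indicator_of_mem hz, bernoulliPairChar, norm_prod, ← Real.exp_add]
    have hσ' := Real.sqrt_pos.2 hσ
    have ha' := Real.sqrt_pos.2 ha
    obtain ⟨⟨hz1, hz2⟩, hz3, hz4⟩ := hz
    set t := z.1 / √(sigHatSq d m) with ht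
    set s := z.2 / √(binomialVar n m) with hs
    have ht' : |t| ≤ Real.pi := by
      rw [abs_le, ht, le_div_iff₀ hσ', div_le_iff₀ hσ']
      exact ⟨hz1, hz2⟩
    have hs' : |s| ≤ Real.pi := by
      rw [abs_le, hs, le_div_iff₀ ha', div_le_iff₀ ha']
      exact ⟨hz3, hz4⟩
    have hs2 : s ^ 2 * binomialVar n m = z.2 ^ 2 := by
      rw [hs, div_pow, Real.sq_sqrt ha.le, div_mul_cancel₀ _ ha.ne']
    have ht2 : t ^ 2 * sigHatSq d m = z.1 ^ 2 := by
      rw [ht, div_pow, Real.sq_sqrt hσ.le, div_mul_cancel₀ _ hσ.ne']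
    refine (Finset.prod_le_prod (fun _ _ => norm_nonneg _) fun j _ =>
      norm_centredBernoulliChar_le _ _).trans ?_
    rw [← Real.exp_sum, Real.exp_le_exp, Finset.sum_neg_distrib, ← Finset.mul_sum]
    have hv := bernoulliVar_nonneg hm
    have h1 := mul_le_mul_of_nonneg_left (h s t hs' ht') hv
    have h2 : (m : ℝ) / n * (1 - (m : ℝ) / n) * (c * n * (s ^ 2 + t ^ 2)) =
        c * (z.2 ^ 2 + t ^ 2 * binomialVar n m) := by
      rw [← hs2, binomialVar]
      ring
    have h3 : z.1 ^ 2 ≤ C * (t ^ 2 * binomialVar n m) := by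
      have := mul_le_mul_of_nonneg_left hQ (mul_nonneg (sq_nonneg t) hv)
      rw [← ht2, sigHatSq, binomialVar]
      linarith
    have h4 : c / C * (z.1 ^ 2 + z.2 ^ 2) ≤ c * (z.2 ^ 2 + t ^ 2 * binomialVar n m) := by
      rw [div_mul_eq_mul_div, div_le_iff₀ (by linarith), mul_assoc]
      refine mul_le_mul_of_nonneg_left ?_ hc.le
      nlinarith [sq_nonneg z.2]
    linarith
  · rw [scaledPairChar, Set.indicator_of_notMem hz, norm_zero]
    positivity

lemma Qval_le_mul_lindebergQuotient_add {n m : ℕ} (hm : m ≤ n) (d : Fin n → ℤ) (ε : ℝ) :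
    Qval d ≤ Qval d * lindebergQuotient d m ε + n * (ε ^ 2 * sigHatSq d m) := by
  have hS := sigHatSq_nonneg hm d
  by_cases hQ : Qval d = 0
  · rw [hQ, zero_mul, zero_add]
    positivity
  · rw [lindebergQuotient, mul_inv_cancel_left₀ hQ]
    have h : ∀ i, ((d i : ℝ) - dbar d) ^ 2 ≤
        (if ε * √(sigHatSq d m) < |(d i : ℝ) - dbar d| then ((d i : ℝ) - dbar d) ^ 2 else 0) +
          ε ^ 2 * sigHatSq d m := by
      intro i
      split_ifs with h
      · exact le_add_of_nonneg_right (by positivity)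
      · have h2 := pow_le_pow_left₀ (abs_nonneg _) (not_lt.1 h) 2
        rwa [sq_abs, mul_pow, Real.sq_sqrt hS, ← zero_add (ε ^ 2 * _)] at h2
    refine (Finset.sum_le_sum fun i _ => h i).trans_eq ?_
    rw [Finset.sum_add_distrib, Finset.sum_const, Finset.card_univ, Fintype.card_fin,
      nsmul_eq_mul]

lemma tendsto_sigHatSq_atTop {nn : ℕ → ℕ} {d : ∀ κ, Fin (nn κ) → ℤ} {m : ℕ → ℕ}
    (hmn : ∀ κ, m κ ≤ nn κ) (hninf : Tendsto nn atTop atTop) {c : ℝ} (hc : 0 < c)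
    (hQ : ∀ᶠ κ in atTop, c * nn κ ≤ Qval (d κ))
    (hlind : ∀ ε : ℝ, 0 < ε →
      Tendsto (fun κ => lindebergQuotient (d κ) (m κ) ε) atTop (𝓝 0)) :
    Tendsto (fun κ => sigHatSq (d κ) (m κ)) atTop atTop := by
  refine tendsto_atTop.2 fun B => ?_
  have hr : 0 < c / (2 * (|B| + 1)) := by positivity
  filter_upwards [hQ, hninf.eventually_gt_atTop 0,
    (hlind _ (Real.sqrt_pos.2 hr)).eventually_lt_const (show (0 : ℝ) < 1 / 2 by norm_num)]
    with κ h1 h2 h3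
  have h4 := Qval_le_mul_lindebergQuotient_add (hmn κ) (d κ) √(c / (2 * (|B| + 1)))
  rw [Real.sq_sqrt hr.le] at h4
  have hn : (0 : ℝ) < nn κ := by exact_mod_cast h2
  have h5 := mul_le_mul_of_nonneg_left h3.le (Qval_nonneg (d κ))
  have h6 : c * nn κ * 1 ≤ c * nn κ * (sigHatSq (d κ) (m κ) / (|B| + 1)) := by
    have : c * nn κ * (sigHatSq (d κ) (m κ) / (|B| + 1)) =
        2 * (nn κ * (c / (2 * (|B| + 1)) * sigHatSq (d κ) (m κ))) := by
      field_simp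
    linarith
  have h7 := (one_le_div (by positivity)).1 (le_of_mul_le_mul_left h6 (by positivity))
  linarith [le_abs_self B]

lemma tendsto_binomialVar_atTop {nn : ℕ → ℕ} {d : ∀ κ, Fin (nn κ) → ℤ} {m : ℕ → ℕ}
    (hmn : ∀ κ, m κ ≤ nn κ) {C : ℝ} (hC : 0 < C) (hQ : ∀ κ, Qval (d κ) ≤ C * nn κ)
    (hσ : Tendsto (fun κ => sigHatSq (d κ) (m κ)) atTop atTop) :
    Tendsto (fun κ => binomialVar (nn κ) (m κ)) atTop atTop := by
  refine (tendsto_const_mul_atTop_of_pos hC).1 (tendsto_atTop_mono (fun κ => ?_) hσ)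
  have := mul_le_mul_of_nonneg_left (hQ κ) (bernoulliVar_nonneg (hmn κ))
  rw [sigHatSq, binomialVar]
  linarith

lemma tendsto_scaledPairChar {nn : ℕ → ℕ} {d : ∀ κ, Fin (nn κ) → ℤ} {m : ℕ → ℕ}
    (hmn : ∀ κ, m κ ≤ nn κ)
    (hσ : Tendsto (fun κ => sigHatSq (d κ) (m κ)) atTop atTop)
    (ha : Tendsto (fun κ => binomialVar (nn κ) (m κ)) atTop atTop)
    (hlind : ∀ ε : ℝ, 0 < ε →
      Tendsto (fun κ => lindebergQuotient (d κ) (m κ) ε) atTop (𝓝 0)) (z : ℝ × ℝ) :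
    Tendsto (fun κ => scaledPairChar (d κ) (m κ) √(sigHatSq (d κ) (m κ))
      √(binomialVar (nn κ) (m κ)) z) atTop (𝓝 (planarGaussian z)) := by
  obtain ⟨v, u⟩ := z
  have hσ' := Real.tendsto_sqrt_atTop.comp hσ
  have ha' := Real.tendsto_sqrt_atTop.comp ha
  have hbox : ∀ {w r : ℝ}, |w| ≤ r → w ∈ Set.Icc (-Real.pi * r) (Real.pi * r) := by
    intro w r h
    have h1 : r ≤ Real.pi * r :=
      le_mul_of_one_le_left ((abs_nonneg w).trans h) (by linarith [Real.pi_gt_three])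
    rw [neg_mul]
    exact abs_le.1 (h.trans h1)
  refine tendsto_iff_norm_sub_tendsto_zero.2 (tendsto_order.2
    ⟨fun b hb => Eventually.of_forall fun κ => hb.trans_le (norm_nonneg _), fun b hb => ?_⟩)
  set ε := min 1 (b / (4 * (u ^ 2 + v ^ 2 + 1)))
  have hε : 0 < ε := lt_min one_pos (by positivity)
  have hεb : 2 * ε * (u ^ 2 + v ^ 2) ≤ b / 2 := by
    have h1 : ε * (4 * (u ^ 2 + v ^ 2 + 1)) ≤ b :=
      (le_div_iff₀ (by positivity)).1 (min_le_right _ _)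
    nlinarith
  have hL := (hlind (ε / (2 * (|v| + 1))) (by positivity)).const_mul (16 * v ^ 2)
  rw [mul_zero] at hL
  filter_upwards [hσ.eventually_gt_atTop 0, ha.eventually_gt_atTop 0,
    hσ'.eventually_ge_atTop |v|, ha'.eventually_ge_atTop |u|,
    ha'.eventually_ge_atTop (2 * |u| / ε), hL.eventually_lt_const (show 0 < b / 2 by linarith)]
    with κ h1 h2 h3 h4 h5 h6
  simp only [Function.comp_apply] at h3 h4 h5
  rw [scaledPairChar, Set.indicator_of_mem (Set.mk_mem_prod (hbox h3) (hbox h4))]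
  have h7 : |u / √(binomialVar (nn κ) (m κ))| ≤ ε / 2 := by
    rw [abs_div, abs_of_pos (Real.sqrt_pos.2 h2), div_le_iff₀ (Real.sqrt_pos.2 h2)]
    linarith [(div_le_iff₀ hε).1 h5]
  have h8 := norm_bernoulliPairChar_sub_planarGaussian_le (hmn κ) (d κ) h1 h2 hε
    (min_le_left _ _) h7 (v := v)
  dsimp only
  linarith

lemma tendsto_integral_norm_scaledPairChar_sub {nn : ℕ → ℕ} {d : ∀ κ, Fin (nn κ) → ℤ}
    {m : ℕ → ℕ} {c C : ℝ} (hmn : ∀ κ, m κ ≤ nn κ) (hc : 0 < c) (hC : 1 ≤ C)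
    (hQ : ∀ κ, Qval (d κ) ≤ C * nn κ)
    (hlower : ∀ᶠ κ in atTop, ∀ s t : ℝ, |s| ≤ Real.pi → |t| ≤ Real.pi →
      c * nn κ * (s ^ 2 + t ^ 2) ≤ ∑ j, (1 - Real.cos (s + t * (d κ j - dbar (d κ)))))
    (hσ : Tendsto (fun κ => sigHatSq (d κ) (m κ)) atTop atTop)
    (ha : Tendsto (fun κ => binomialVar (nn κ) (m κ)) atTop atTop)
    (hlind : ∀ ε : ℝ, 0 < ε →
      Tendsto (fun κ => lindebergQuotient (d κ) (m κ) ε) atTop (𝓝 0))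
    {α : Type*} [MeasurableSpace α] {μ : Measure α} {f : α → ℝ × ℝ} (hf : Measurable f)
    (hbound : ∀ b : ℝ, 0 < b → Integrable
      (fun x => Real.exp (-b * (f x).1 ^ 2) * Real.exp (-b * (f x).2 ^ 2)) μ) :
    Tendsto (fun κ => ∫ x, ‖scaledPairChar (d κ) (m κ) √(sigHatSq (d κ) (m κ))
      √(binomialVar (nn κ) (m κ)) (f x) - planarGaussian (f x)‖ ∂μ) atTop (𝓝 0) := by
  have hmeas : ∀ κ, Measurable fun x => ‖scaledPairChar (d κ) (m κ) √(sigHatSq (d κ) (m κ))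
      √(binomialVar (nn κ) (m κ)) (f x) - planarGaussian (f x)‖ := by
    intro κ
    have h1 : Measurable planarGaussian := by
      unfold planarGaussian
      fun_prop
    refine (Measurable.sub (Measurable.comp ?_ hf) (h1.comp hf)).norm
    exact ((continuous_bernoulliPairChar (d κ) (m κ)).comp
      (f := fun z : ℝ × ℝ => (z.2 / √(binomialVar (nn κ) (m κ)),
        z.1 / √(sigHatSq (d κ) (m κ)))) (by fun_prop)).measurable.indicator
      (measurableSet_Icc.prod measurableSet_Icc)
  have hgauss : ∀ z, ‖planarGaussian z‖ =
      Real.exp (-(1 / 2) * z.1 ^ 2) * Real.exp (-(1 / 2) * z.2 ^ 2) := by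
    intro z
    rw [planarGaussian, norm_mul, Complex.norm_real, Complex.norm_real, Real.norm_eq_abs,
      Real.norm_eq_abs, Real.abs_exp, Real.abs_exp]
    congr 2 <;> ring
  rw [← integral_zero α ℝ (μ := μ)]
  refine tendsto_integral_filter_of_dominated_convergence
    (fun x => Real.exp (-(c / C) * (f x).1 ^ 2) * Real.exp (-(c / C) * (f x).2 ^ 2) +
      Real.exp (-(1 / 2) * (f x).1 ^ 2) * Real.exp (-(1 / 2) * (f x).2 ^ 2))
    (Eventually.of_forall fun κ => (hmeas κ).aestronglyMeasurable) ?_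
    ((hbound _ (by positivity)).add (hbound _ (by norm_num))) ?_
  · filter_upwards [hlower, hσ.eventually_gt_atTop 0, ha.eventually_gt_atTop 0] with κ h1 h2 h3
    refine Eventually.of_forall fun x => ?_
    rw [norm_norm, ← hgauss]
    exact (norm_sub_le _ _).trans
      (add_le_add_left (norm_scaledPairChar_le (hmn κ) (d κ) hc hC (hQ κ) h2 h3 h1 _) _)
  · exact Eventually.of_forall fun x => tendsto_iff_norm_sub_tendsto_zero.1
      (tendsto_scaledPairChar hmn hσ ha hlind (f x))

lemma abs_sqrt_mul_probPerm_sub_exp_le {n m : ℕ} (hn : 0 < n) (hm : m ≤ n) (d : Fin n → ℤ)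
    (k : ℤ) {S a : ℝ} (hS : 0 < S) (ha : 0 < a)
    (he : ∫ u : ℝ, ‖scaledPairChar d m √S a (0, u) - planarGaussian (0, u)‖ ≤ 1 / 2) :
    |√(2 * Real.pi * S) * probPerm (fun τ => sampleSum d m τ = k) -
        Real.exp (-((k : ℝ) - (m : ℝ) * dbar d) ^ 2 / (2 * S))| ≤
      2 * ((∫ z : ℝ × ℝ, ‖scaledPairChar d m √S a z - planarGaussian z‖) +
        ∫ u : ℝ, ‖scaledPairChar d m √S a (0, u) - planarGaussian (0, u)‖) := by
  have hσ := Real.sqrt_pos.2 hS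
  have h1 := abs_probPerm_sub_exp_le hn hm d k hσ ha
  have h2 := abs_binomialMass_sub_le (m := m) hn d hσ ha
  set e₁ := ∫ z : ℝ × ℝ, ‖scaledPairChar d m √S a z - planarGaussian z‖
  set e₂ := ∫ u : ℝ, ‖scaledPairChar d m √S a (0, u) - planarGaussian (0, u)‖
  set P := probPerm fun τ => sampleSum d m τ = k
  have hexp : -((k - m * dbar d) / √S) ^ 2 / 2 =
      -((k : ℝ) - (m : ℝ) * dbar d) ^ 2 / (2 * S) := by
    rw [div_pow, Real.sq_sqrt hS.le]
    field_simp
  rw [hexp] at h1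
  set g := Real.exp (-((k : ℝ) - (m : ℝ) * dbar d) ^ 2 / (2 * S))
  have hg0 : 0 ≤ g := Real.exp_nonneg _
  have hg1 : g ≤ 1 := by
    refine Real.exp_le_one_iff.2 (div_nonpos_of_nonpos_of_nonneg ?_ (by positivity))
    exact neg_nonpos.2 (sq_nonneg _)
  have hpi : 1 ≤ 2 * Real.pi := by linarith [Real.pi_gt_three]
  have hr : 1 ≤ √(2 * Real.pi) := Real.one_le_sqrt.2 hpi
  have hrr := Real.mul_self_sqrt (show 0 ≤ 2 * Real.pi by positivity)
  rw [Real.sqrt_mul (by positivity)]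
  set r := √(2 * Real.pi)
  set W := r * √S * P with hW
  set Y := a * r * binomialMass n m with hY
  have hX : √S * a * (2 * Real.pi) ^ 2 * binomialMass n m * P - 2 * Real.pi * g =
      2 * Real.pi * (W * Y - g) := by
    rw [hW, hY]
    linear_combination (-2 * Real.pi * √S * a * binomialMass n m * P) * hrr
  have hY1 : a * (2 * Real.pi) * binomialMass n m - r = r * (Y - 1) := by
    rw [hY]
    linear_combination (-a * binomialMass n m) * hrr
  rw [hX, abs_mul, abs_of_pos (by linarith)] at h1
  rw [hY1, abs_mul, abs_of_pos (by linarith)] at h2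
  have h3 := (le_mul_of_one_le_left (abs_nonneg _) hpi).trans h1
  have h4 := (le_mul_of_one_le_left (abs_nonneg _) hr).trans h2
  have hY2 : 1 / 2 ≤ Y := by linarith [(abs_le.1 h4).1]
  have h5 : |W - g| * Y ≤ e₁ + e₂ := by
    rw [← abs_of_pos (show 0 < Y by linarith), ← abs_mul]
    calc |(W - g) * Y| = |(W * Y - g) - g * (Y - 1)| := by congr 1; ring
      _ ≤ |W * Y - g| + |g * (Y - 1)| := abs_sub _ _
      _ ≤ e₁ + e₂ := by
        rw [abs_mul, abs_of_nonneg hg0]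
        exact add_le_add h3 ((mul_le_of_le_one_left (abs_nonneg _) hg1).trans h4)
  nlinarith [abs_nonneg (W - g)]

/-- Theorem A.2: local limit theorem for sums of values drawn without replacement. -/
theorem local_limit_sampling
    (nn : ℕ → ℕ) (d : ∀ κ, Fin (nn κ) → ℤ) (m : ℕ → ℕ) (p : ℤ → ℝ)
    (hmn : ∀ κ, m κ ≤ nn κ)
    (hninf : Tendsto nn atTop atTop)
    (hp0 : ∀ k, 0 ≤ p k) (hp1 : HasSum p 1) (hnl : NonlatticeZ p)
    (hemp : ∀ k : ℤ, Tendsto (fun κ => empFreq (d κ) k) atTop (𝓝 (p k)))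
    (hQ : ∃ C : ℝ, ∀ κ, Qval (d κ) ≤ C * (nn κ : ℝ))
    (hlind : ∀ ε : ℝ, 0 < ε → Tendsto (fun κ =>
        (Qval (d κ))⁻¹ *
          ∑ i : Fin (nn κ),
            if ε * Real.sqrt (sigHatSq (d κ) (m κ)) < |(d κ i : ℝ) - dbar (d κ)| then
              ((d κ i : ℝ) - dbar (d κ)) ^ 2
            else 0)
      atTop (𝓝 0)) :
    Tendsto (fun κ => ⨆ k : ℤ,
        |Real.sqrt (2 * Real.pi * sigHatSq (d κ) (m κ)) *
            probPerm (fun τ => sampleSum (d κ) (m κ) τ = k) -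
          Real.exp (-((k : ℝ) - (m κ : ℝ) * dbar (d κ)) ^ 2 /
            (2 * sigHatSq (d κ) (m κ)))|)
      atTop (𝓝 0) := by
  obtain ⟨C, hC⟩ := hQ
  obtain ⟨c, hc, hlower⟩ := exists_eventually_mul_sq_add_sq_le hninf hnl hemp hC
  have hQ' : ∀ κ, Qval (d κ) ≤ max C 1 * nn κ := fun κ =>
    (hC κ).trans (mul_le_mul_of_nonneg_right (le_max_left _ _) (Nat.cast_nonneg _))
  have hQlow : ∀ᶠ κ in atTop, c * nn κ ≤ Qval (d κ) := by
    filter_upwards [hlower] with κ h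
    have h1 := h 0 1 (by simp [Real.pi_pos.le]) (by
      rw [abs_one]
      linarith [Real.pi_gt_three])
    have h2 : ∑ j, (1 - Real.cos (0 + 1 * (d κ j - dbar (d κ)))) ≤ Qval (d κ) := by
      refine Finset.sum_le_sum fun j _ => ?_
      rw [zero_add, one_mul]
      linarith [Real.one_sub_sq_div_two_le_cos (x := (d κ j : ℝ) - dbar (d κ)),
        sq_nonneg ((d κ j : ℝ) - dbar (d κ))]
    linarith
  have hσ := tendsto_sigHatSq_atTop hmn hninf hc hQlow hlind
  have ha := tendsto_binomialVar_atTop hmn (one_pos.trans_le (le_max_right C 1)) hQ' hσ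
  have he₁ := tendsto_integral_norm_scaledPairChar_sub hmn hc (le_max_right C 1) hQ' hlower hσ ha
    hlind (μ := volume) (f := fun z : ℝ × ℝ => z) measurable_id fun b hb =>
      (integrable_exp_neg_mul_sq hb).mul_prod (integrable_exp_neg_mul_sq hb)
  have he₂ := tendsto_integral_norm_scaledPairChar_sub hmn hc (le_max_right C 1) hQ' hlower hσ ha
    hlind (μ := volume) (f := fun u : ℝ => ((0 : ℝ), u)) (by fun_prop) fun b hb => by
      simpa using integrable_exp_neg_mul_sq hb
  have he := (he₁.add he₂).const_mul 2
  rw [add_zero, mul_zero] at he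
  refine squeeze_zero' (Eventually.of_forall fun κ => Real.iSup_nonneg fun k => abs_nonneg _)
    ?_ he
  filter_upwards [hninf.eventually_gt_atTop 0, hσ.eventually_gt_atTop 0,
    ha.eventually_gt_atTop 0, he₂.eventually_le_const (show (0 : ℝ) < 1 / 2 by norm_num)]
    with κ h1 h2 h3 h4
  exact ciSup_le fun k =>
    abs_sqrt_mul_probPerm_sub_exp_le h1 (hmn κ) (d κ) k h2 (Real.sqrt_pos.2 h3) h4
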